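/- arXiv:1508.03185 — 6 statements merged into one kernel-verified Lean document; each statement's English description precedes it below -/
import Mathlib

section
/- Let A₁,…,A₆ be six points in ℝ³ such that no four of them lie in a common plane (equivalently, every four of them are affinely independent). Then there exist two disjoint triples of these points such that the two triangles with vertices at these triples are linked, i.e., the intrinsic frontier (the boundary contour) of the triangle spanned by the first triple intersects the intrinsic interior of the triangle spanned by the second triple in exactly one point. -/
theorem mem_convexHull_range_iff_exists_weights {ι E : Type*} [Fintype ι] [AddCommGroup E]
    [Module ℝ E] (p : ι → E) (x : E) :
    x ∈ convexHull ℝ (Set.range p) ↔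
      ∃ w : ι → ℝ, (∀ i, 0 ≤ w i) ∧ ∑ i, w i = 1 ∧ ∑ i, w i • p i = x := by
  classical
  have h : convexHull ℝ (Set.range p) = Fintype.linearCombination ℝ p '' stdSimplex ℝ ι := by
    rw [← convexHull_rangle_single_eq_stdSimplex, LinearMap.image_convexHull, ← Set.range_comp]
    congr 2
    ext i
    simp [Fintype.linearCombination_apply_single]
  rw [h]
  simp [stdSimplex, Fintype.linearCombination_apply, and_assoc]

section IntrinsicInterior

variable {ι E : Type*} [NormedAddCommGroup E] [NormedSpace ℝ E]

theorem AffineIndependent.exists_affineBasis_affineSpan [Finite ι] [Nonempty ι] {p : ι → E}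
    (hp : AffineIndependent ℝ p) {S : AffineSubspace ℝ E} [Nonempty S]
    (hS : S = affineSpan ℝ (Set.range p)) :
    ∃ b : AffineBasis ι ℝ S, ∀ i, (b i : E) = p i := by
  subst hS
  have hmem : ∀ i, p i ∈ affineSpan ℝ (Set.range p) := fun i =>
    subset_affineSpan ℝ _ (Set.mem_range_self i)
  let q : ι → affineSpan ℝ (Set.range p) := fun i => ⟨p i, hmem i⟩
  have hq : (affineSpan ℝ (Set.range p)).subtype ∘ q = p := rfl
  refine ⟨⟨q, AffineIndependent.of_comp (affineSpan ℝ (Set.range p)).subtype (by rwa [hq]), ?_⟩,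
    fun i => rfl⟩
  have : Set.range q = ((↑) : affineSpan ℝ (Set.range p) → E) ⁻¹' Set.range p := by
    ext x
    simp [q, Subtype.ext_iff]
  rw [this]
  exact affineSpan_coe_preimage_eq_top (Set.range p)

theorem AffineIndependent.mem_intrinsicInterior_and_mem_intrinsicFrontier [Fintype ι] [Nontrivial ι]
    {p : ι → E}
    (hp : AffineIndependent ℝ p) (x : E) {w : ι → ℝ} (hw : ∑ i, w i = 1)
    (hx : ∑ i, w i • p i = x) :
    (x ∈ intrinsicInterior ℝ (convexHull ℝ (Set.range p)) ↔ ∀ i, 0 < w i) ∧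
    (x ∈ intrinsicFrontier ℝ (convexHull ℝ (Set.range p)) ↔ (∀ i, 0 ≤ w i) ∧ ∃ i, w i = 0) := by
  unfold intrinsicInterior intrinsicFrontier
  have hS := affineSpan_convexHull (𝕜 := ℝ) (Set.range p)
  have hxS : x ∈ affineSpan ℝ (convexHull ℝ (Set.range p)) := by
    rw [hS, ← hx, ← Finset.affineCombination_eq_linear_combination _ _ _ hw]
    exact affineCombination_mem_affineSpan hw p
  generalize affineSpan ℝ (convexHull ℝ (Set.range p)) = S at hS hxS ⊢
  have : Nonempty S := ⟨⟨x, hxS⟩⟩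
  obtain ⟨b, hb⟩ := hp.exists_affineBasis_affineSpan hS
  have hsum : ∀ y : S, ∑ i, b.coord i y • p i = (y : E) := fun y => by
    have h := congrArg S.subtype (b.affineCombination_coord_eq_self y)
    rw [Finset.map_affineCombination _ _ _ (b.sum_coord_apply_eq_one y),
      Finset.affineCombination_eq_linear_combination _ _ _ (b.sum_coord_apply_eq_one y)] at h
    simpa [hb] using h
  have huniq : ∀ (y : S) (v : ι → ℝ), ∑ i, v i = 1 → ∑ i, v i • p i = y → ∀ i, b.coord i y = v i :=
    fun y v hv hy i => hp.eq_of_sum_eq_sum (by rw [hv, b.sum_coord_apply_eq_one])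
      ((hsum y).trans hy.symm) i (Finset.mem_univ i)
  have hpre : ((↑) ⁻¹' convexHull ℝ (Set.range p) : Set S) = ⋂ i, b.coord i ⁻¹' Set.Ici 0 := by
    ext y
    simp only [Set.mem_preimage, mem_convexHull_range_iff_exists_weights, Set.mem_iInter,
      Set.mem_Ici]
    constructor
    · rintro ⟨v, hv0, hv, hy⟩ i
      rw [huniq y v hv hy i]
      exact hv0 i
    · exact fun h => ⟨fun i => b.coord i y, h, b.sum_coord_apply_eq_one y, hsum y⟩
  have : FiniteDimensional ℝ S.direction := b.finiteDimensional
  have hint : interior ((↑) ⁻¹' convexHull ℝ (Set.range p) : Set S) =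
      ⋂ i, b.coord i ⁻¹' Set.Ioi 0 := by
    simp only [hpre, interior_iInter_of_finite, ←
      IsOpenMap.preimage_interior_eq_interior_preimage (isOpenMap_barycentric_coord b _)
        (continuous_barycentric_coord b _), interior_Ici]
  have hclosed : IsClosed ((↑) ⁻¹' convexHull ℝ (Set.range p) : Set S) := by
    rw [hpre]
    exact isClosed_iInter fun i => isClosed_Ici.preimage (continuous_barycentric_coord b i)
  have hcoord := huniq ⟨x, hxS⟩ w hw hx
  rw [hclosed.frontier_eq, hint, hpre]
  constructor
  · simp [hxS, hcoord]
  · simp only [Set.mem_image, Subtype.exists, exists_and_right, exists_eq_right, hxS, hcoord,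
      Set.mem_sdiff, Set.mem_iInter, Set.mem_preimage, Set.mem_Ici, Set.mem_Ioi, exists_true_left,
      not_forall, not_lt]
    exact and_congr_right fun h => exists_congr fun i =>
      ⟨fun hi => le_antisymm hi (h i), fun hi => hi.le⟩

theorem isClosed_convexHull_image_finset (A : ι → E) (s : Finset ι) :
    IsClosed (convexHull ℝ (A '' (s : Set ι))) :=
  ((s.finite_toSet.image A).isCompact_convexHull ℝ).isClosed

theorem mem_convexHull_image_finset_iff_exists_weights (A : ι → E) (s : Finset ι) (x : E) :
    x ∈ convexHull ℝ (A '' (s : Set ι)) ↔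
      ∃ w : ι → ℝ, (∀ i ∈ s, 0 ≤ w i) ∧ ∑ i ∈ s, w i = 1 ∧ ∑ i ∈ s, w i • A i = x := by
  classical
  rw [Set.image_eq_range]
  refine (mem_convexHull_range_iff_exists_weights (fun i : s => A i) x).trans ?_
  constructor
  · rintro ⟨w, hw0, hw1, hwx⟩
    refine ⟨fun i => if h : i ∈ s then w ⟨i, h⟩ else 0, fun i hi => by simpa [hi] using hw0 ⟨i, hi⟩,
      ?_, ?_⟩
    · rw [← Finset.sum_coe_sort, ← hw1]
      simp
    · rw [← Finset.sum_coe_sort, ← hwx]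
      simp
  · rintro ⟨w, hw0, hw1, hwx⟩
    refine ⟨fun i => w i, fun i => hw0 i i.2, ?_, ?_⟩
    · rw [← hw1, Finset.sum_coe_sort s w]
    · rw [← hwx, Finset.sum_coe_sort s fun i => w i • A i]

theorem AffineIndependent.mem_intrinsicInterior_and_mem_intrinsicFrontier_finset {A : ι → E}
    {s : Finset ι} (hA : AffineIndependent ℝ fun i : s => A i) (hs : 1 < s.card) (x : E)
    {w : ι → ℝ} (hw : ∑ i ∈ s, w i = 1) (hx : ∑ i ∈ s, w i • A i = x) :
    (x ∈ intrinsicInterior ℝ (convexHull ℝ (A '' (s : Set ι))) ↔ ∀ i ∈ s, 0 < w i) ∧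
    (x ∈ intrinsicFrontier ℝ (convexHull ℝ (A '' (s : Set ι))) ↔
      (∀ i ∈ s, 0 ≤ w i) ∧ ∃ i ∈ s, w i = 0) := by
  have : Nontrivial s := by
    rw [← Fintype.one_lt_card_iff_nontrivial]
    simpa using hs
  have h := hA.mem_intrinsicInterior_and_mem_intrinsicFrontier x (w := fun i : s => w i)
    (by rw [Finset.sum_coe_sort s w, hw])
    (by rw [Finset.sum_coe_sort s fun i => w i • A i, hx])
  rw [Set.image_eq_range]
  simpa using h

end IntrinsicInterior

section AffineRelations

variable {ι E : Type*} [Fintype ι] [AddCommGroup E] [Module ℝ E]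

/-- The space of affine relations of a finite family of points: the coefficient vectors with zero
sum whose associated linear combination of the points vanishes. -/
def affineRelations (A : ι → E) : Submodule ℝ (ι → ℝ) :=
  LinearMap.ker (Fintype.linearCombination ℝ fun i => ((1 : ℝ), A i))

theorem mem_affineRelations {A : ι → E} {d : ι → ℝ} :
    d ∈ affineRelations A ↔ ∑ i, d i = 0 ∧ ∑ i, d i • A i = 0 := by
  simp [affineRelations, Fintype.linearCombination_apply, Prod.ext_iff, Prod.fst_sum, Prod.snd_sum]

theorem exists_ne_zero_mem_affineRelations_apply_eq_zero [FiniteDimensional ℝ E] (A : ι → E)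
    (h : Module.finrank ℝ E + 2 < Fintype.card ι) (k : ι) :
    ∃ d ∈ affineRelations A, d ≠ 0 ∧ d k = 0 := by
  let f := (Fintype.linearCombination ℝ fun i => ((1 : ℝ), A i)).prod
    (LinearMap.proj k : (ι → ℝ) →ₗ[ℝ] ℝ)
  have hf : LinearMap.ker f ≠ ⊥ := LinearMap.ker_ne_bot_of_finrank_lt (by simp; omega)
  obtain ⟨d, hd, hd0⟩ := Submodule.exists_mem_ne_zero_of_ne_bot hf
  simp only [f, LinearMap.ker_prod, Submodule.mem_inf] at hd
  exact ⟨d, hd.1, hd0, hd.2⟩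

theorem eq_zero_of_mem_affineRelations [DecidableEq ι] {A : ι → E} {s : Finset ι}
    (hA : AffineIndependent ℝ fun i : s => A i) {d : ι → ℝ} (hd : d ∈ affineRelations A)
    (hs : ∀ i ∉ s, d i = 0) : d = 0 := by
  rw [mem_affineRelations] at hd
  have h := hA.eq_zero_of_sum_eq_zero (s := Finset.univ) (w := fun i : s => d i)
    (by rw [Finset.sum_coe_sort s d, ← hd.1]
        exact Finset.sum_subset (Finset.subset_univ s) fun i _ hi => hs i hi)
    (by rw [Finset.sum_coe_sort s fun i => d i • A i, ← hd.2]
        exact Finset.sum_subset (Finset.subset_univ s) fun i _ hi => by rw [hs i hi, zero_smul])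
  ext i
  by_cases hi : i ∈ s
  · exact h ⟨i, hi⟩ (Finset.mem_univ _)
  · exact hs i hi

end AffineRelations

theorem exists_intrinsicFrontier_inter_intrinsicInterior_eq_singleton {ι E : Type*} [Fintype ι]
    [DecidableEq ι] [NormedAddCommGroup E] [NormedSpace ℝ E] {A : ι → E} {s : Finset ι}
    (hs : 1 < s.card) (hs' : 1 < sᶜ.card)
    (hA : AffineIndependent ℝ fun i : s => A i)
    (hA' : AffineIndependent ℝ fun i : (sᶜ : Finset ι) => A i)
    {k l : ι} (hk : k ∈ s) (hl : l ∉ s)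
    (huniq : ∀ d ∈ affineRelations A, d k = 0 → d l = 0 → d = 0)
    {d e : ι → ℝ} (hd : d ∈ affineRelations A) (he : e ∈ affineRelations A)
    (hdk : d k = 0) (hdpos : ∀ i ∈ s, i ≠ k → 0 < d i) (hdneg : ∀ i ∉ s, d i < 0)
    (hel : e l = 0) (hepos : ∀ i ∈ s, 0 < e i) :
    ∃ p : E, intrinsicFrontier ℝ (convexHull ℝ (A '' (s : Set ι))) ∩
      intrinsicInterior ℝ (convexHull ℝ (A '' ((sᶜ : Finset ι) : Set ι))) = {p} := by
  set c := ∑ i ∈ s, d i with hc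
  have hd' := mem_affineRelations.1 hd
  rw [← Finset.sum_add_sum_compl s, ← Finset.sum_add_sum_compl s] at hd'
  have hc' : ∑ i ∈ sᶜ, d i = -c := by linarith [hd'.1]
  have hcpos : 0 < c := by
    have : ∑ i ∈ sᶜ, d i < 0 :=
      Finset.sum_neg (fun i hi => hdneg i (Finset.mem_compl.1 hi)) ⟨l, Finset.mem_compl.2 hl⟩
    linarith
  refine ⟨c⁻¹ • ∑ i ∈ s, d i • A i, Set.eq_singleton_iff_unique_mem.2 ⟨⟨?_, ?_⟩, ?_⟩⟩
  · refine (hA.mem_intrinsicInterior_and_mem_intrinsicFrontier_finset hs _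
      (w := fun i => c⁻¹ * d i) ?_ ?_).2.2 ⟨fun i hi => ?_, k, hk, by simp [hdk]⟩
    · rw [← Finset.mul_sum, ← hc, inv_mul_cancel₀ hcpos.ne']
    · simp only [mul_smul, Finset.smul_sum]
    · obtain rfl | hik := eq_or_ne i k
      · simp [hdk]
      · exact mul_nonneg (inv_nonneg.2 hcpos.le) (hdpos i hi hik).le
  · refine (hA'.mem_intrinsicInterior_and_mem_intrinsicFrontier_finset hs' _
      (w := fun i => -(c⁻¹ * d i)) ?_ ?_).1.2 fun i hi => ?_
    · rw [Finset.sum_neg_distrib, ← Finset.mul_sum, hc', mul_neg, neg_neg,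
        inv_mul_cancel₀ hcpos.ne']
    · rw [eq_neg_of_add_eq_zero_left hd'.2, ← Finset.sum_neg_distrib, Finset.smul_sum]
      simp only [mul_smul, smul_neg, neg_smul]
    · have := mul_neg_of_pos_of_neg (inv_pos.2 hcpos) (hdneg i (Finset.mem_compl.1 hi))
      linarith
  · rintro q ⟨hqf, hqi⟩
    obtain ⟨w, -, hw1, hwq⟩ := (mem_convexHull_image_finset_iff_exists_weights A s q).1
      (intrinsicFrontier_subset (isClosed_convexHull_image_finset A s) hqf)
    obtain ⟨v, -, hv1, hvq⟩ := (mem_convexHull_image_finset_iff_exists_weights A sᶜ q).1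
      (intrinsicInterior_subset hqi)
    obtain ⟨hw0, j, hj, hwj⟩ :=
      (hA.mem_intrinsicInterior_and_mem_intrinsicFrontier_finset hs q hw1 hwq).2.1 hqf
    have hv0 := (hA'.mem_intrinsicInterior_and_mem_intrinsicFrontier_finset hs' q hv1 hvq).1.1 hqi
    let f : ι → ℝ := fun i => if i ∈ s then w i else -v i
    have hfs : ∀ i ∈ s, f i = w i := fun i hi => if_pos hi
    have hfs' : ∀ i ∈ sᶜ, f i = -v i := fun i hi => if_neg (Finset.mem_compl.1 hi)
    have hf : f ∈ affineRelations A := by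
      rw [mem_affineRelations, ← Finset.sum_add_sum_compl s, ← Finset.sum_add_sum_compl s,
        Finset.sum_congr rfl hfs, Finset.sum_congr rfl hfs',
        Finset.sum_congr rfl fun i hi => congrArg (· • A i) (hfs i hi),
        Finset.sum_congr rfl fun i hi => congrArg (· • A i) (hfs' i hi)]
      simp [hw1, hwq, hv1, hvq]
    set a := f l / d l with ha
    set b := f k / e k with hb
    have hdl := hdneg l hl
    have hek := hepos k hk
    have hapos : 0 < a := by
      have := hv0 l (Finset.mem_compl.2 hl)
      refine div_pos_of_neg_of_neg ?_ hdl
      rw [hfs' l (Finset.mem_compl.2 hl)]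
      linarith
    have hbnn : 0 ≤ b := div_nonneg (by rw [hfs k hk]; exact hw0 k hk) hek.le
    have hcomb : f - a • d - b • e = 0 := by
      refine huniq _ (Submodule.sub_mem _ (Submodule.sub_mem _ hf (Submodule.smul_mem _ _ hd))
        (Submodule.smul_mem _ _ he)) ?_ ?_
      · simp [hdk, hb, hek.ne']
      · simp [hel, ha, hdl.ne]
    have hcomb' : ∀ i, f i = a * d i + b * e i := fun i => by
      have := congrFun hcomb i
      simp only [Pi.sub_apply, Pi.smul_apply, smul_eq_mul, Pi.zero_apply] at this
      linarith
    have hjk : j = k := by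
      by_contra hne
      have h1 := hcomb' j
      rw [hfs j hj, hwj] at h1
      have := mul_pos hapos (hdpos j hj hne)
      have := mul_nonneg hbnn (hepos j hj).le
      linarith
    have hb0 : b = 0 := by rw [hb, hfs k hk, ← hjk, hwj, zero_div]
    have hwd : ∀ i ∈ s, w i = a * d i := fun i hi => by rw [← hfs i hi, hcomb', hb0]; ring
    have hac : a * c = 1 := by
      rw [hc, Finset.mul_sum, ← Finset.sum_congr rfl hwd, hw1]
    rw [← hwq, ← eq_inv_of_mul_eq_one_left hac, Finset.smul_sum]
    exact Finset.sum_congr rfl fun i hi => by rw [hwd i hi, mul_smul]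

theorem exists_pencil_mem_affineRelations {ι E : Type*} [Fintype ι] [AddCommGroup E] [Module ℝ E]
    [FiniteDimensional ℝ E] {A : ι → E} (hcard : Module.finrank ℝ E + 2 < Fintype.card ι)
    (huniq : ∀ k l, k ≠ l → ∀ d ∈ affineRelations A, d k = 0 → d l = 0 → d = 0) :
    ∃ u r : ι → ℝ, (∀ i, u i ≠ 0) ∧ Function.Injective r ∧
      ∀ t : ℝ, (fun i => u i * (t - r i)) ∈ affineRelations A := by
  obtain ⟨x, y, hxy⟩ := Fintype.exists_pair_of_one_lt_card (α := ι) (by omega)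
  obtain ⟨v, hv, hv0, hvx⟩ := exists_ne_zero_mem_affineRelations_apply_eq_zero A hcard x
  obtain ⟨w, hw, hw0, hwy⟩ := exists_ne_zero_mem_affineRelations_apply_eq_zero A hcard y
  obtain ⟨c, hc⟩ := Set.Infinite.nonempty
    (Set.Finite.infinite_compl (Set.finite_range fun i => -v i / w i))
  have hu : ∀ i, (v + c • w) i ≠ 0 := by
    intro i hi
    simp only [Pi.add_apply, Pi.smul_apply, smul_eq_mul] at hi
    by_cases hwi : w i = 0
    · have hiy : i = y := by
        by_contra hne
        exact hw0 (huniq i y hne w hw hwi hwy)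
      rw [hwi, mul_zero, add_zero, hiy] at hi
      exact hv0 (huniq x y hxy v hv hvx hi)
    · exact hc ⟨i, by field_simp; linarith⟩
  have hmem : ∀ t : ℝ, t • (v + c • w) - w ∈ affineRelations A := fun t =>
    Submodule.sub_mem _ (Submodule.smul_mem _ _ (Submodule.add_mem _ hv (Submodule.smul_mem _ _ hw)))
      hw
  generalize v + c • w = u at hu hmem
  refine ⟨u, fun i => w i / u i, hu, fun i j hij => ?_, fun t => ?_⟩
  · by_contra hne
    have h := huniq i j hne _ (hmem (w i / u i)) (by simp [hu]) (by
      have : w i / u i = w j / u j := hij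
      simp [this, hu])
    have hr : w i / u i = 0 := by
      have := congrFun h y
      simpa [hwy, hu] using this
    rw [hr, zero_smul, zero_sub, neg_eq_zero] at h
    exact hw0 h
  · convert hmem t using 1
    ext i
    have := hu i
    simp only [Pi.sub_apply, Pi.smul_apply, smul_eq_mul]
    field_simp

theorem exists_balanced_sign_change (ε : Fin 6 → Bool) :
    ∃ (δ : Bool) (m : Fin 6),
      (Finset.univ.filter fun i => (ε i ^^ (decide (i ≤ m) ^^ δ)) = true).card = 3 ∧
        (ε m ^^ (decide (m ≤ m) ^^ δ)) = true ∧
        (ε (m + 1) ^^ (decide (m + 1 ≤ m) ^^ δ)) = false := by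
  revert ε
  decide +kernel

theorem exists_intrinsicFrontier_inter_eq_singleton_of_strictMono_pencil {E : Type*}
    [NormedAddCommGroup E] [NormedSpace ℝ E] {A : Fin 6 → E}
    (hA : ∀ s : Finset (Fin 6), s.card = 3 → AffineIndependent ℝ fun i : s => A i)
    (huniq : ∀ k l, k ≠ l → ∀ d ∈ affineRelations A, d k = 0 → d l = 0 → d = 0)
    {u r : Fin 6 → ℝ} (hu : ∀ i, u i ≠ 0) (hr : StrictMono r)
    (hpencil : ∀ t : ℝ, (fun i => u i * (t - r i)) ∈ affineRelations A) :
    ∃ s : Finset (Fin 6), s.card = 3 ∧ ∃ p : E,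
      intrinsicFrontier ℝ (convexHull ℝ (A '' (s : Set (Fin 6)))) ∩
        intrinsicInterior ℝ (convexHull ℝ (A '' ((sᶜ : Finset (Fin 6)) : Set (Fin 6)))) = {p} := by
  obtain ⟨δ, m, hcard, hm, hm'⟩ := exists_balanced_sign_change fun i => decide (u i < 0)
  set s := Finset.univ.filter fun i => (decide (u i < 0) ^^ (decide (i ≤ m) ^^ δ)) = true with hs
  let τ : ℝ := if δ then -1 else 1
  let g : Fin 6 → ℝ := fun i => if i ≤ m then 1 else -1
  let κ : ℝ := if m = 5 then -1 else 1
  have hsign : ∀ i, (i ∈ s → 0 < τ * u i * g i) ∧ (i ∉ s → τ * u i * g i < 0) := by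
    intro i
    obtain h | h := lt_or_gt_of_ne (hu i) <;> by_cases hi : i ≤ m <;> cases δ <;>
      simp [hs, τ, g, h, hi, h.not_gt]
  have hgr : ∀ i, i ≠ m → 0 < g i * (r m - r i) := by
    intro i hi
    obtain h | h := lt_or_gt_of_ne hi
    · simpa [g, h.le] using hr h
    · simpa [g, h.not_ge] using hr h
  have hgr' : ∀ i, i ≠ m + 1 → 0 < κ * g i * (r (m + 1) - r i) := by
    intro i hi
    have hlast : ∀ i m : Fin 6, m = 5 → i ≠ m + 1 → i ≤ m ∧ m + 1 < i := by decide
    have hle : ∀ i m : Fin 6, m ≠ 5 → i ≤ m → i < m + 1 := by decide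
    have hgt : ∀ i m : Fin 6, m ≠ 5 → i ≠ m + 1 → ¬ i ≤ m → m + 1 < i := by decide
    by_cases hm5 : m = 5
    · obtain ⟨h, h'⟩ := hlast i m hm5 hi
      have hκ : κ = -1 := if_pos hm5
      have hg : g i = 1 := if_pos h
      rw [hκ, hg]
      linarith [hr h']
    · by_cases h : i ≤ m
      · simpa [κ, g, hm5, h] using hr (hle i m hm5 h)
      · simpa [κ, g, hm5, h] using hr (hgt i m hm5 hi h)
  have hgg : ∀ i, g i * g i = 1 := fun i => by
    by_cases h : i ≤ m <;> simp [g, h]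
  have hms : m ∈ s := by simpa [hs] using hm
  have hms' : m + 1 ∉ s := by simpa [hs] using hm'
  have hcard' : sᶜ.card = 3 := by rw [Finset.card_compl, hcard]; rfl
  have hd : ∀ i, τ * (u i * (r m - r i)) = (τ * u i * g i) * (g i * (r m - r i)) := fun i => by
    linear_combination (-(τ * u i * (r m - r i))) * hgg i
  have he : ∀ i, (τ * κ) * (u i * (r (m + 1) - r i)) =
      (τ * u i * g i) * (κ * g i * (r (m + 1) - r i)) := fun i => by
    linear_combination (-(τ * κ * u i * (r (m + 1) - r i))) * hgg i
  refine ⟨s, hcard, exists_intrinsicFrontier_inter_intrinsicInterior_eq_singleton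
    (by omega) (by omega) (hA s hcard) (hA sᶜ hcard') hms hms'
    (huniq m (m + 1) fun h => hms' (h ▸ hms))
    (Submodule.smul_mem _ τ (hpencil (r m))) (Submodule.smul_mem _ (τ * κ) (hpencil (r (m + 1))))
    (by simp) (fun i hi him => ?_) (fun i hi => ?_) (by simp) (fun i hi => ?_)⟩
  · simp only [Pi.smul_apply, smul_eq_mul, hd]
    exact mul_pos ((hsign i).1 hi) (hgr i him)
  · simp only [Pi.smul_apply, smul_eq_mul, hd]
    exact mul_neg_of_neg_of_pos ((hsign i).2 hi) (hgr i fun h => hi (h ▸ hms))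
  · simp only [Pi.smul_apply, smul_eq_mul, he]
    exact mul_pos ((hsign i).1 hi) (hgr' i fun h => hms' (h ▸ hi))

/-- Linear Conway–Gordon–Sachs theorem, special case: among any 6 points in ℝ³
such that every 4 of them are affinely independent, there are two disjoint
triples spanning linked triangles, i.e. the intrinsic frontier of the first
triangle meets the intrinsic interior of the second in exactly one point. -/
theorem linear_conway_gordon_sachs_dim3
    (A : Fin 6 → EuclideanSpace ℝ (Fin 3))
    (hgen : ∀ s : Finset (Fin 6), s.card = 4 →
      AffineIndependent ℝ (fun i : s => A i)) :
    ∃ s t : Finset (Fin 6), s.card = 3 ∧ t.card = 3 ∧ Disjoint s t ∧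
      ∃ p : EuclideanSpace ℝ (Fin 3),
        intrinsicFrontier ℝ (convexHull ℝ (A '' (s : Set (Fin 6)))) ∩
          intrinsicInterior ℝ (convexHull ℝ (A '' (t : Set (Fin 6)))) = {p} := by
  have huniq : ∀ B : Fin 6 → EuclideanSpace ℝ (Fin 3),
      (∀ s : Finset (Fin 6), s.card = 4 → AffineIndependent ℝ (fun i : s => B i)) →
      ∀ k l, k ≠ l → ∀ d ∈ affineRelations B, d k = 0 → d l = 0 → d = 0 :=
    fun B hB k l hkl d hd hk hl => eq_zero_of_mem_affineRelations
      (hB ({k, l}ᶜ) (by rw [Finset.card_compl, Finset.card_pair hkl]; rfl)) hd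
      fun i hi => by
        rw [Finset.mem_compl, not_not, Finset.mem_insert, Finset.mem_singleton] at hi
        obtain rfl | rfl := hi
        exacts [hk, hl]
  obtain ⟨u, r, hu, hr, hpencil⟩ := exists_pencil_mem_affineRelations (A := A) (by simp)
    (huniq A hgen)
  let σ := Tuple.sort r
  have hσ : StrictMono (r ∘ σ) :=
    (Tuple.monotone_sort r).strictMono_of_injective (hr.comp σ.injective)
  have hgenσ : ∀ s : Finset (Fin 6), s.card = 4 → AffineIndependent ℝ fun i : s => (A ∘ σ) i := by
    intro s hs
    let f : s ↪ (s.map σ.toEmbedding : Finset (Fin 6)) :=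
      ⟨fun i => ⟨σ i, Finset.mem_map_of_mem σ.toEmbedding i.2⟩,
        fun i j hij => Subtype.ext (σ.injective (congrArg Subtype.val hij))⟩
    exact (hgen (s.map σ.toEmbedding) (by rwa [Finset.card_map])).comp_embedding f
  have hgenσ3 : ∀ s : Finset (Fin 6), s.card = 3 →
      AffineIndependent ℝ fun i : s => (A ∘ σ) i := by
    intro s hs
    obtain ⟨t, hst, ht⟩ := Finset.exists_superset_card_eq (s := s) (n := 4) (by omega) (by simp)
    let f : s ↪ t := ⟨fun i => ⟨i, hst i.2⟩, fun i j hij => Subtype.ext (Subtype.mk.inj hij)⟩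
    exact (hgenσ t ht).comp_embedding f
  obtain ⟨s, hs, p, hp⟩ := exists_intrinsicFrontier_inter_eq_singleton_of_strictMono_pencil hgenσ3
    (huniq (A ∘ σ) hgenσ) (u := u ∘ σ) (fun i => hu (σ i)) hσ fun t => by
      have h := mem_affineRelations.1 (hpencil t)
      rw [mem_affineRelations]
      exact ⟨(Equiv.sum_comp σ fun i => u i * (t - r i)).trans h.1,
        (Equiv.sum_comp σ fun i => (u i * (t - r i)) • A i).trans h.2⟩
  refine ⟨s.map σ.toEmbedding, sᶜ.map σ.toEmbedding, by rwa [Finset.card_map], ?_, ?_, p, ?_⟩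
  · rw [Finset.card_map, Finset.card_compl, hs]
    rfl
  · exact (Finset.disjoint_map _).2 disjoint_compl_right
  · simpa only [Finset.coe_map, Equiv.coe_toEmbedding, ← Set.image_comp] using hp
end

section
/- Let A₁,…,A₇ be seven points in ℝ⁴ such that no five of them lie in a common three-dimensional affine subspace (equivalently, every five of them are affinely independent). Then one can choose two disjoint triples among these points such that the triangles with vertices at these triples intersect, i.e., the convex hulls of the two triples have a common point. -/
/-- The number of coordinates of a real vector that are positive is lower semicontinuous. -/
lemma isClosed_setOf_card_pos_le {ι : Type*} [Fintype ι] (k : ℕ) :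
    IsClosed {w : ι → ℝ | (Finset.univ.filter fun i => 0 < w i).card ≤ k} := by
  rw [← isOpen_compl_iff, isOpen_iff_mem_nhds]
  intro w hw
  simp only [Set.mem_compl_iff, Set.mem_ofPred_eq, not_le] at hw
  have hpos : ∀ᶠ v in nhds w, ∀ i, 0 < w i → 0 < v i := by
    rw [Filter.eventually_all]
    intro i
    by_cases hi : 0 < w i
    · filter_upwards [(continuous_apply i).continuousAt.eventually (lt_mem_nhds hi)] with v hv _
      exact hv
    · exact Filter.Eventually.of_forall fun v h => absurd h hi
  filter_upwards [hpos] with v hv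
  simp only [Set.mem_compl_iff, Set.mem_ofPred_eq, not_le]
  exact hw.trans_le (Finset.card_le_card (Finset.monotone_filter_right _ fun i _ => hv i))

/-- A subspace of dimension at least two of `ℝ^ι`, with `ι` of size at most `2 * k + 1`, contains a
nonzero vector with at most `k` positive and at most `k` negative coordinates. -/
lemma Submodule.exists_ne_zero_card_pos_le_card_neg_le {ι : Type*} [Fintype ι] {k : ℕ}
    (hk : Fintype.card ι ≤ 2 * k + 1) (V : Submodule ℝ (ι → ℝ))
    (hV : 1 < Module.finrank ℝ V) :
    ∃ w ∈ V, w ≠ 0 ∧ (Finset.univ.filter fun i => 0 < w i).card ≤ k ∧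
      (Finset.univ.filter fun i => w i < 0).card ≤ k := by
  classical
  set P : Set V := {w | (Finset.univ.filter fun i => 0 < (w : ι → ℝ) i).card ≤ k} with hP
  set N : Set V := {w | (Finset.univ.filter fun i => (w : ι → ℝ) i < 0).card ≤ k} with hN
  have hNP : ∀ w, -w ∈ P ↔ w ∈ N := fun w => by simp [hP, hN]
  have hPN : ∀ w, -w ∈ N ↔ w ∈ P := fun w => by simp [hP, hN]
  have hPc : IsClosed P := (isClosed_setOf_card_pos_le k).preimage continuous_subtype_val
  have hNc : IsClosed N := by
    have : N = Neg.neg ⁻¹' P := by ext w; exact (hNP w).symm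
    rw [this]
    exact hPc.preimage continuous_neg
  have hcover : ∀ w, w ∈ P ∨ w ∈ N := by
    intro w
    by_contra! h
    have h1 : k < (Finset.univ.filter fun i => 0 < (w : ι → ℝ) i).card := not_le.mp h.1
    have h2 : k < (Finset.univ.filter fun i => (w : ι → ℝ) i < 0).card := not_le.mp h.2
    have hd : Disjoint (Finset.univ.filter fun i => 0 < (w : ι → ℝ) i)
        (Finset.univ.filter fun i => (w : ι → ℝ) i < 0) :=
      Finset.disjoint_filter.2 fun i _ hi => hi.le.not_gt
    have := Finset.card_union_of_disjoint hd ▸ Finset.card_le_univ _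
    omega
  have hconn : IsPreconnected ({0}ᶜ : Set V) :=
    (isConnected_compl_singleton_of_one_lt_rank
      (Module.lt_rank_of_lt_finrank (by exact_mod_cast hV)) 0).isPreconnected
  have : Nontrivial V := Module.nontrivial_of_finrank_pos (zero_lt_one.trans hV)
  obtain ⟨v, hv⟩ := exists_ne (0 : V)
  have hmeet : (({0}ᶜ : Set V) ∩ P).Nonempty ∧ (({0}ᶜ : Set V) ∩ N).Nonempty := by
    rcases hcover v with h | h
    · exact ⟨⟨v, hv, h⟩, ⟨-v, neg_ne_zero.2 hv, (hPN v).2 h⟩⟩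
    · exact ⟨⟨-v, neg_ne_zero.2 hv, (hNP v).2 h⟩, ⟨v, hv, h⟩⟩
  obtain ⟨w, hw0, hwP, hwN⟩ := isPreconnected_closed_iff.1 hconn P N hPc hNc
    (fun w _ => hcover w) hmeet.1 hmeet.2
  exact ⟨w, w.2, fun h => hw0 (Subtype.ext h), hwP, hwN⟩

/-- A sum of terms vanishing where `w` does splits over the positive and negative support of `w`. -/
lemma sum_eq_sum_pos_add_sum_neg {ι M : Type*} [Fintype ι] [AddCommMonoid M] (w : ι → ℝ)
    (f : ι → M) (hf : ∀ i, w i = 0 → f i = 0) :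
    ∑ i, f i = ∑ i with 0 < w i, f i + ∑ i with w i < 0, f i := by
  rw [← Finset.sum_filter_add_sum_filter_not Finset.univ (fun i => 0 < w i)]
  congr 1
  symm
  refine Finset.sum_subset (fun i hi => ?_) fun i hi hi' => hf i ?_
  · simp only [Finset.mem_filter_univ] at hi ⊢
    exact hi.not_gt
  · simp only [Finset.mem_filter_univ, not_lt] at hi hi'
    exact le_antisymm hi hi'

/-- The positive and negative parts of a nontrivial affine dependency give a point common to the
convex hulls of the corresponding points (Radon's argument). -/
lemma exists_mem_convexHull_pos_neg {ι E : Type*} [Fintype ι] [AddCommGroup E] [Module ℝ E]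
    (A : ι → E) {w : ι → ℝ} (hw : w ≠ 0) (hsum : ∑ i, w i = 0) (hA : ∑ i, w i • A i = 0) :
    ∃ p, p ∈ convexHull ℝ (A '' {i | 0 < w i}) ∧ p ∈ convexHull ℝ (A '' {i | w i < 0}) := by
  set P := Finset.univ.filter fun i => 0 < w i
  set N := Finset.univ.filter fun i => w i < 0
  have hS : ∑ i ∈ N, -w i = ∑ i ∈ P, w i := by
    rw [Finset.sum_neg_distrib, eq_comm, ← add_eq_zero_iff_eq_neg, ← hsum]
    exact (sum_eq_sum_pos_add_sum_neg w w fun _ => id).symm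
  have hV : ∑ i ∈ N, -w i • A i = ∑ i ∈ P, w i • A i := by
    simp only [neg_smul]
    rw [Finset.sum_neg_distrib, eq_comm, ← add_eq_zero_iff_eq_neg, ← hA]
    exact (sum_eq_sum_pos_add_sum_neg w (fun i => w i • A i) fun i hi => by simp [hi]).symm
  have hpos : 0 < ∑ i ∈ P, w i := by
    obtain ⟨i, -, hi⟩ := Finset.exists_pos_of_sum_zero_of_exists_nonzero w hsum
      (by simpa using Function.ne_iff.1 hw)
    exact Finset.sum_pos (fun j hj => (Finset.mem_filter.1 hj).2)
      ⟨i, Finset.mem_filter.2 ⟨Finset.mem_univ i, hi⟩⟩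
  refine ⟨P.centerMass w A, Finset.centerMass_mem_convexHull _
    (fun i hi => (Finset.mem_filter.1 hi).2.le) hpos
    fun i hi => Set.mem_image_of_mem A (Finset.mem_filter.1 hi).2, ?_⟩
  have : P.centerMass w A = N.centerMass (fun i => -w i) A := by
    simp only [Finset.centerMass, hS, hV]
  rw [this]
  exact Finset.centerMass_mem_convexHull _
    (fun i hi => neg_nonneg.2 (Finset.mem_filter.1 hi).2.le) (hS ▸ hpos)
    fun i hi => Set.mem_image_of_mem A (Finset.mem_filter.1 hi).2

/-- Linear van Kampen–Flores theorem, special case: among any 7 points in ℝ⁴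
such that every 5 of them are affinely independent, one can choose two disjoint
triples such that the triangles (convex hulls) spanned by them intersect. -/
theorem linear_van_kampen_flores_dim4
    (A : Fin 7 → EuclideanSpace ℝ (Fin 4))
    (hgen : ∀ s : Finset (Fin 7), s.card = 5 →
      AffineIndependent ℝ (fun i : s => A i)) :
    ∃ s t : Finset (Fin 7), s.card = 3 ∧ t.card = 3 ∧ Disjoint s t ∧
      ∃ p : EuclideanSpace ℝ (Fin 4),
        p ∈ convexHull ℝ (A '' (s : Set (Fin 7))) ∧
        p ∈ convexHull ℝ (A '' (t : Set (Fin 7))) := by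
  let L : (Fin 7 → ℝ) →ₗ[ℝ] EuclideanSpace ℝ (Fin 4) × ℝ :=
    (Fintype.linearCombination ℝ A).prod (Fintype.linearCombination ℝ fun _ => (1 : ℝ))
  have hker : 1 < Module.finrank ℝ (LinearMap.ker L) := by
    have hadd := L.finrank_range_add_finrank_ker
    have hle := (LinearMap.range L).finrank_le
    simp only [Module.finrank_prod, finrank_euclideanSpace, Module.finrank_self,
      Module.finrank_fintype_fun_eq_card, Fintype.card_fin] at hadd hle
    omega
  obtain ⟨w, hwL, hw0, hP, hN⟩ := (LinearMap.ker L).exists_ne_zero_card_pos_le_card_neg_le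
    (k := 3) (by simp) hker
  have hw : ∑ i, w i • A i = 0 ∧ ∑ i, w i = 0 := by
    simpa [L, Fintype.linearCombination_apply] using hwL
  obtain ⟨p, hp, hp'⟩ := exists_mem_convexHull_pos_neg A hw0 hw.2 hw.1
  set P := Finset.univ.filter fun i => 0 < w i with hPdef
  set N := Finset.univ.filter fun i => w i < 0 with hNdef
  have hPN : P ⊆ Nᶜ := fun i hi => by
    simp only [hPdef, hNdef, Finset.mem_compl, Finset.mem_filter_univ] at hi ⊢
    exact hi.not_gt
  obtain ⟨s, hPs, hsN, hs⟩ := Finset.exists_subsuperset_card_eq hPN hP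
    (by rw [Finset.card_compl, Fintype.card_fin]; omega)
  obtain ⟨t, hNt, hts, ht⟩ := Finset.exists_subsuperset_card_eq
    (Finset.subset_compl_comm.1 hsN) hN (by rw [Finset.card_compl, Fintype.card_fin]; omega)
  refine ⟨s, t, hs, ht, (Finset.subset_compl_iff_disjoint_left.1 hts), p,
    convexHull_mono (Set.image_mono fun i hi => hPs ?_) hp,
    convexHull_mono (Set.image_mono fun i hi => hNt ?_) hp'⟩
  · exact Finset.mem_filter.2 ⟨Finset.mem_univ i, hi⟩
  · exact Finset.mem_filter.2 ⟨Finset.mem_univ i, hi⟩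
end

section
/- Let n be an odd positive integer and let A₁,…,A_{n+3} be n+3 points in general position in ℝⁿ. Then there exist two disjoint subsets of these points, each consisting of (n+3)/2 points, such that the two ((n+1)/2)-dimensional simplices given by their convex hulls are linked: the intrinsic frontier of the convex hull of the first subset intersects the intrinsic interior of the convex hull of the second subset in exactly one point. -/
section Simplex

open Set

variable {ι E : Type*} [Fintype ι] [NormedAddCommGroup E] [NormedSpace ℝ E] {p : ι → E}

/-- Barycentric coordinates of an affinely independent family extend to a continuous map on the
whole space. -/
lemma AffineIndependent.exists_continuous_coord [FiniteDimensional ℝ E]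
    (hp : AffineIndependent ℝ p) :
    ∃ c : E → ι → ℝ, Continuous c ∧ ∀ w : ι → ℝ, ∑ i, w i = 1 → c (∑ i, w i • p i) = w := by
  let L : (ι → ℝ) →ₗ[ℝ] E × ℝ :=
    (Fintype.linearCombination ℝ p).prod (Fintype.linearCombination ℝ fun _ => 1)
  have hL : ∀ w, L w = (∑ i, w i • p i, ∑ i, w i) := fun w => by
    simp [L, Fintype.linearCombination_apply]
  obtain ⟨g, hg⟩ := L.exists_leftInverse_of_injective <| LinearMap.ker_eq_bot'.2 fun w hw => by
    rw [hL, Prod.mk_eq_zero] at hw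
    exact funext fun i => hp.eq_zero_of_sum_eq_zero hw.2 hw.1 i (Finset.mem_univ i)
  refine ⟨fun x => g (x, 1), g.continuous_of_finiteDimensional.comp (by fun_prop), fun w hw => ?_⟩
  have := LinearMap.congr_fun hg w
  rwa [LinearMap.comp_apply, hL, hw] at this

lemma mem_affineSpan_range_iff_exists_sum {x : E} :
    x ∈ affineSpan ℝ (range p) ↔ ∃ w : ι → ℝ, ∑ i, w i = 1 ∧ ∑ i, w i • p i = x := by
  constructor
  · intro hx
    obtain ⟨w, hw, rfl⟩ := eq_affineCombination_of_mem_affineSpan_of_fintype hx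
    exact ⟨w, hw, (Finset.affineCombination_eq_linear_combination _ _ _ hw).symm⟩
  · rintro ⟨w, hw, rfl⟩
    rw [← Finset.affineCombination_eq_linear_combination _ _ _ hw]
    exact affineCombination_mem_affineSpan hw p

lemma mem_convexHull_range_iff_exists_sum {x : E} :
    x ∈ convexHull ℝ (range p) ↔
      ∃ w : ι → ℝ, (∀ i, 0 ≤ w i) ∧ ∑ i, w i = 1 ∧ ∑ i, w i • p i = x := by
  constructor
  · intro hx
    classical
    rw [convexHull_range_eq_exists_affineCombination] at hx
    obtain ⟨s, w, hw0, hw1, rfl⟩ := hx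
    refine ⟨fun i => if i ∈ s then w i else 0, fun i => ?_, ?_, ?_⟩
    · dsimp only
      split_ifs with h
      exacts [hw0 i h, le_rfl]
    · simpa using hw1
    · rw [Finset.affineCombination_eq_linear_combination _ _ _ hw1]
      simp [ite_smul]
  · rintro ⟨w, hw0, hw1, hx⟩
    exact mem_convexHull_of_exists_fintype w p hw0 hw1 (fun i => mem_range_self i) hx

lemma AffineIndependent.mem_intrinsicInterior_convexHull_iff [FiniteDimensional ℝ E]
    (hp : AffineIndependent ℝ p) {x : E} :
    x ∈ intrinsicInterior ℝ (convexHull ℝ (range p)) ↔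
      ∃ w : ι → ℝ, (∀ i, 0 < w i) ∧ ∑ i, w i = 1 ∧ ∑ i, w i • p i = x := by
  obtain ⟨c, hc, hcw⟩ := hp.exists_continuous_coord
  have hspan : ∀ y : E, y ∈ affineSpan ℝ (convexHull ℝ (range p)) ↔
      ∃ w : ι → ℝ, ∑ i, w i = 1 ∧ ∑ i, w i • p i = y := fun y => by
    rw [affineSpan_convexHull, mem_affineSpan_range_iff_exists_sum]
  rw [mem_intrinsicInterior]
  constructor
  · rintro ⟨y, hy, rfl⟩
    have hyC := interior_subset hy
    rw [mem_preimage] at hyC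
    obtain ⟨w, hw0, hw1, hwy⟩ := mem_convexHull_range_iff_exists_sum.1 hyC
    refine ⟨w, fun i => (hw0 i).lt_of_ne' fun hi => ?_, hw1, hwy⟩
    classical
    -- moving slightly away from the vertex `i` stays in the simplex, but `w i` becomes negative
    let v : ℝ → ι → ℝ := fun t j => (1 + t) * w j - t * Pi.single (M := fun _ => ℝ) i 1 j
    have hv : ∀ t, ∑ j, v t j = 1 := fun t => by
      simp [v, Finset.sum_sub_distrib, ← Finset.mul_sum, hw1]
    let f : ℝ → affineSpan ℝ (convexHull ℝ (range p)) := fun t =>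
      ⟨∑ j, v t j • p j, (hspan _).2 ⟨v t, hv t, rfl⟩⟩
    have hf : Continuous f := by
      refine Continuous.subtype_mk ?_ _
      fun_prop
    have hf0 : f 0 = y := Subtype.ext <| by simp [f, v, hwy]
    have hev : ∀ᶠ t in nhds (0 : ℝ), f t ∈ ((↑) ⁻¹' convexHull ℝ (range p) :
        Set (affineSpan ℝ (convexHull ℝ (range p)))) :=
      (hf.tendsto 0).eventually (by rw [hf0]; exact mem_interior_iff_mem_nhds.1 hy)
    obtain ⟨t, ht, htpos⟩ := ((hev.filter_mono nhdsWithin_le_nhds).and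
      (self_mem_nhdsWithin : Ioi (0 : ℝ) ∈ nhdsWithin 0 (Ioi 0))).exists
    obtain ⟨w', hw0', hw1', hwt⟩ := mem_convexHull_range_iff_exists_sum.1 ht
    have hvw : v t = w' := by rw [← hcw _ (hv t), ← hcw _ hw1', hwt]
    have := hw0' i
    rw [← hvw] at this
    simp only [v, hi, Pi.single_eq_same] at this htpos
    linarith
  · rintro ⟨w, hw0, hw1, rfl⟩
    refine ⟨⟨_, (hspan _).2 ⟨w, hw1, rfl⟩⟩, ?_, rfl⟩
    refine mem_interior.2 ⟨{y | ∀ i, 0 < c y i}, ?_, ?_, ?_⟩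
    · rintro ⟨y, hy⟩ hpos
      obtain ⟨w', hw1', rfl⟩ := (hspan y).1 hy
      simp only [mem_ofPred_eq, hcw w' hw1'] at hpos
      exact mem_convexHull_range_iff_exists_sum.2 ⟨w', fun i => (hpos i).le, hw1', rfl⟩
    · simp only [ofPred_forall]
      exact isOpen_iInter_of_finite fun i => isOpen_lt continuous_const (by fun_prop)
    · simpa [hcw w hw1] using hw0

lemma AffineIndependent.mem_intrinsicFrontier_convexHull_iff [FiniteDimensional ℝ E]
    (hp : AffineIndependent ℝ p) {x : E} :
    x ∈ intrinsicFrontier ℝ (convexHull ℝ (range p)) ↔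
      ∃ w : ι → ℝ, (∀ i, 0 ≤ w i) ∧ (∃ i, w i = 0) ∧ ∑ i, w i = 1 ∧ ∑ i, w i • p i = x := by
  rw [← closure_sdiff_intrinsicInterior, ((finite_range p).isCompact_convexHull ℝ).isClosed.closure_eq,
    mem_sdiff, mem_convexHull_range_iff_exists_sum, hp.mem_intrinsicInterior_convexHull_iff]
  constructor
  · rintro ⟨⟨w, hw0, hw1, hx⟩, hn⟩
    refine ⟨w, hw0, ?_, hw1, hx⟩
    by_contra! h
    exact hn ⟨w, fun i => (hw0 i).lt_of_ne' (h i), hw1, hx⟩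
  · rintro ⟨w, hw0, ⟨i, hi⟩, hw1, hx⟩
    refine ⟨⟨w, hw0, hw1, hx⟩, ?_⟩
    rintro ⟨w', hw0', hw1', hx'⟩
    have := hp.eq_of_sum_eq_sum (hw1.trans hw1'.symm) (hx.trans hx'.symm) i (Finset.mem_univ i)
    exact (hw0' i).ne (hi.symm.trans this)

end Simplex

section FinsetSimplex

variable {ι E : Type*} [NormedAddCommGroup E] [NormedSpace ℝ E] [FiniteDimensional ℝ E]
  {A : ι → E} {s : Finset ι}

lemma mem_intrinsicInterior_convexHull_image_iff (hs : AffineIndependent ℝ fun i : s => A i)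
    {x : E} :
    x ∈ intrinsicInterior ℝ (convexHull ℝ (A '' (s : Set ι))) ↔
      ∃ w : ι → ℝ, (∀ i ∈ s, 0 < w i) ∧ ∑ i ∈ s, w i = 1 ∧ ∑ i ∈ s, w i • A i = x := by
  classical
  have h := hs.mem_intrinsicInterior_convexHull_iff (x := x)
  rw [Set.image_eq_range]
  refine h.trans ⟨?_, ?_⟩
  · rintro ⟨w, hw0, hw1, hx⟩
    refine ⟨fun i => if h : i ∈ s then w ⟨i, h⟩ else 0, fun i hi => by simp [hi, hw0], ?_, ?_⟩
    · rw [← Finset.sum_coe_sort]; simpa using hw1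
    · rw [← Finset.sum_coe_sort]; simpa using hx
  · rintro ⟨w, hw0, hw1, hx⟩
    exact ⟨fun i => w i, fun i => hw0 i i.2, by rwa [Finset.sum_coe_sort],
      by rwa [Finset.sum_coe_sort s fun i => w i • A i]⟩

lemma mem_intrinsicFrontier_convexHull_image_iff (hs : AffineIndependent ℝ fun i : s => A i)
    {x : E} :
    x ∈ intrinsicFrontier ℝ (convexHull ℝ (A '' (s : Set ι))) ↔
      ∃ w : ι → ℝ, (∀ i ∈ s, 0 ≤ w i) ∧ (∃ i ∈ s, w i = 0) ∧
        ∑ i ∈ s, w i = 1 ∧ ∑ i ∈ s, w i • A i = x := by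
  classical
  have h := hs.mem_intrinsicFrontier_convexHull_iff (x := x)
  rw [Set.image_eq_range]
  refine h.trans ⟨?_, ?_⟩
  · rintro ⟨w, hw0, ⟨j, hj⟩, hw1, hx⟩
    refine ⟨fun i => if h : i ∈ s then w ⟨i, h⟩ else 0, fun i hi => by simp [hi, hw0],
      ⟨j, j.2, by simp [hj]⟩, ?_, ?_⟩
    · rw [← Finset.sum_coe_sort]; simpa using hw1
    · rw [← Finset.sum_coe_sort]; simpa using hx
  · rintro ⟨w, hw0, ⟨j, hjs, hj⟩, hw1, hx⟩
    exact ⟨fun i => w i, fun i => hw0 i i.2, ⟨⟨j, hjs⟩, hj⟩, by rwa [Finset.sum_coe_sort],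
      by rwa [Finset.sum_coe_sort s fun i => w i • A i]⟩

end FinsetSimplex

open Finset in
/-- A balanced cut: if the elements `i` with `p i` form more than half of a linearly ordered
finite type, then some two consecutive elements `a < b` satisfy `p`, and
reversing `p` above `a` gives a set of exactly half the size. -/
lemma Fin.exists_balanced_cut {N k : ℕ} (hN : N = 2 * k) (p : Fin N → Prop) [DecidablePred p]
    (hp : k < #{i | p i}) :
    ∃ a b : Fin N, (b : ℕ) = a + 1 ∧ p a ∧ p b ∧ #{i | i ≤ a ↔ p i} = k := by
  let Q : ℕ → Finset (Fin N) := fun m => {i | (i : ℕ) < m ↔ p i}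
  have hstep : ∀ m (hm : m < N), #(Q (m + 1)) + (if p ⟨m, hm⟩ then 0 else 1) =
      #(Q m) + (if p ⟨m, hm⟩ then 1 else 0) := by
    intro m hm
    split_ifs with h
    · have : Q (m + 1) = insert ⟨m, hm⟩ (Q m) := by
        ext i
        simp only [Q, mem_filter, mem_univ, true_and, mem_insert, Fin.ext_iff]
        rcases eq_or_ne (i : ℕ) m with hi | hi
        · obtain rfl : i = ⟨m, hm⟩ := Fin.ext hi
          simp [h]
        · rw [show (i : ℕ) < m + 1 ↔ (i : ℕ) < m by omega]
          simp [hi]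
      rw [this, card_insert_of_notMem (by simp [Q, h])]
    · have : Q m = insert ⟨m, hm⟩ (Q (m + 1)) := by
        ext i
        simp only [Q, mem_filter, mem_univ, true_and, mem_insert, Fin.ext_iff]
        rcases eq_or_ne (i : ℕ) m with hi | hi
        · obtain rfl : i = ⟨m, hm⟩ := Fin.ext hi
          simp [h]
        · rw [show (i : ℕ) < m + 1 ↔ (i : ℕ) < m by omega]
          simp [hi]
      rw [this, card_insert_of_notMem (by simp [Q, h])]
  have hlast : k < #(Q N) := by simpa [Q] using hp
  have hzero : #(Q 0) < k := by
    have : #{i | p i} + #{i | ¬p i} = N := by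
      simpa using card_filter_add_card_filter_not (s := (univ : Finset (Fin N))) p
    have h0 : #(Q 0) = #{i | ¬p i} := by simp [Q]
    omega
  classical
  have hex : ∃ m, k < #(Q m) := ⟨N, hlast⟩
  have hm := Nat.find_spec hex
  have hmin : ∀ l < Nat.find hex, #(Q l) ≤ k := fun l hl => not_lt.1 (Nat.find_min hex hl)
  have hmN : Nat.find hex ≤ N := Nat.find_min' hex hlast
  generalize Nat.find hex = m at hm hmin hmN
  obtain _ | _ | m := m
  · omega
  · have h1 := hstep 0 (by omega)
    split_ifs at h1 <;> omega
  · have h1 := hstep m (by omega)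
    have h2 := hstep (m + 1) (by omega)
    have h3 := hmin m (by omega)
    have h4 := hmin (m + 1) (by omega)
    have hpb : p ⟨m + 1, by omega⟩ := by
      by_contra h
      simp only [h, if_false] at h2
      omega
    simp only [hpb, if_true] at h2
    have hk : #(Q (m + 1)) = k := by omega
    have hpa : p ⟨m, by omega⟩ := by
      by_contra h
      simp only [h, if_false] at h1
      omega
    refine ⟨⟨m, by omega⟩, ⟨m + 1, by omega⟩, rfl, hpa, hpb, ?_⟩
    simpa only [Q, Fin.le_def, Nat.lt_succ_iff] using hk

open Finset in
lemma exists_balanced_cut {N k : ℕ} (hN : N = 2 * k) {r : Fin N → ℝ} (hr : r.Injective)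
    (p : Fin N → Prop) [DecidablePred p] (hp : k < #{i | p i}) :
    ∃ a b : Fin N, r a < r b ∧ (∀ c, r c ≤ r a ∨ r b ≤ r c) ∧ p a ∧ p b ∧
      #{i | r i ≤ r a ↔ p i} = k := by
  let e := Tuple.sort r
  have he : StrictMono (r ∘ e) :=
    (Tuple.monotone_sort r).strictMono_of_injective (hr.comp e.injective)
  have hcard : ∀ (q : Fin N → Prop) [DecidablePred q], #{i | q (e i)} = #{i | q i} := by
    intro q _
    exact card_equiv e (by simp)
  obtain ⟨a, b, hab, ha, hb, h⟩ := Fin.exists_balanced_cut hN (fun i => p (e i))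
    (by rwa [hcard p])
  refine ⟨e a, e b, he (by rw [Fin.lt_def]; omega), fun c => ?_, ha, hb, ?_⟩
  · obtain ⟨c, rfl⟩ := e.surjective c
    rcases le_or_gt c a with hc | hc
    · exact .inl (he.monotone hc)
    · exact .inr (he.monotone (by rw [Fin.lt_def] at hc; rw [Fin.le_def]; omega))
  · rw [← h, ← hcard]
    have hle : ∀ i, r (e i) ≤ r (e a) ↔ i ≤ a := fun i => he.le_iff_le
    simp only [hle]

section Dependencies

open Finset

variable {ι E : Type*} [Fintype ι] [AddCommGroup E] [Module ℝ E]

/-- The space of affine dependencies of a finite family of points. -/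
def affineDependencies (A : ι → E) : Submodule ℝ (ι → ℝ) :=
  LinearMap.ker ((Fintype.linearCombination ℝ A).prod (Fintype.linearCombination ℝ fun _ => (1 : ℝ)))

lemma mem_affineDependencies {A : ι → E} {μ : ι → ℝ} :
    μ ∈ affineDependencies A ↔ ∑ i, μ i • A i = 0 ∧ ∑ i, μ i = 0 := by
  simp [affineDependencies, Fintype.linearCombination_apply]

lemma exists_mem_affineDependencies_apply_eq_zero [FiniteDimensional ℝ E] (A : ι → E)
    (hcard : Module.finrank ℝ E + 2 < Fintype.card ι) (i : ι) :
    ∃ μ ∈ affineDependencies A, μ ≠ 0 ∧ μ i = 0 := by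
  let L : (ι → ℝ) →ₗ[ℝ] (E × ℝ) × ℝ :=
    ((Fintype.linearCombination ℝ A).prod (Fintype.linearCombination ℝ fun _ => (1 : ℝ))).prod
      (LinearMap.proj i)
  have hL : LinearMap.ker L ≠ ⊥ := LinearMap.ker_ne_bot_of_finrank_lt (by simpa using hcard)
  obtain ⟨μ, hμ, hne⟩ := Submodule.exists_mem_ne_zero_of_ne_bot hL
  simp only [L, LinearMap.ker_prod, Submodule.mem_inf] at hμ
  exact ⟨μ, by simpa [affineDependencies] using hμ.1, hne, hμ.2⟩

/-- A planar space of functions on `ι` whose nonzero elements vanish at most once is a pencil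
spanned by `u` and `u * r`, where `u` has no zeros, is positive on more than
half of `ι`, and `r` is injective. -/
lemma exists_unbalanced_pencil {k : ℕ} (hι : Fintype.card ι = 2 * k) {i₀ i₁ : ι} (hi : i₀ ≠ i₁)
    (D : Submodule ℝ (ι → ℝ)) (hD : ∀ i, ∃ μ ∈ D, μ ≠ 0 ∧ μ i = 0)
    (hD' : ∀ μ ∈ D, ∀ i j, i ≠ j → μ i = 0 → μ j = 0 → μ = 0) :
    ∃ u r : ι → ℝ, r.Injective ∧ k < #{i | 0 < u i} ∧ u ∈ D ∧ u * r ∈ D ∧ (∀ i, u i ≠ 0) ∧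
      ∀ μ ∈ D, ∃ α β : ℝ, ∀ i, μ i = u i * (α - β * r i) := by
  classical
  obtain ⟨w, hwD, hw, hw0⟩ := hD i₀
  obtain ⟨z, hzD, hz1, hz0⟩ : ∃ z ∈ D, z i₁ = 0 ∧ 0 < z i₀ := by
    obtain ⟨z, hzD, hz, hz1⟩ := hD i₁
    rcases lt_trichotomy (z i₀) 0 with h | h | h
    · exact ⟨-z, D.neg_mem hzD, by simp [hz1], by simpa using h⟩
    · exact absurd (hD' z hzD _ _ hi h hz1) hz
    · exact ⟨z, hzD, hz1, h⟩
  have hwne : ∀ j, j ≠ i₀ → w j ≠ 0 := fun j hj h => hw (hD' w hwD _ _ hj h hw0)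
  obtain ⟨t, ht, htpos⟩ : ∃ t : ℝ, (∀ j, j ≠ i₀ → |t * z j| < |w j|) ∧ 0 < t := by
    have hev : ∀ᶠ t : ℝ in nhds 0, ∀ j, j ≠ i₀ → |t * z j| < |w j| := by
      refine Filter.eventually_all.2 fun j => ?_
      by_cases hj : j = i₀
      · simp [hj]
      · have hc : Continuous fun t : ℝ => |t * z j| := by fun_prop
        filter_upwards [(hc.tendsto 0).eventually_lt_const (u := |w j|)
          (by simpa using hwne j hj)] with t ht _ using ht
    exact ((hev.filter_mono nhdsWithin_le_nhds).and
      (self_mem_nhdsWithin : Set.Ioi (0 : ℝ) ∈ nhdsWithin 0 (Set.Ioi 0))).exists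
  have hsign : ∀ ε : ℝ, |ε| = 1 → ∀ j, j ≠ i₀ →
      (0 < w j + ε * t * z j ↔ 0 < w j) ∧ w j + ε * t * z j ≠ 0 := by
    intro ε hε j hj
    have h : |ε * t * z j| < |w j| := by
      rw [mul_assoc, abs_mul, hε, one_mul]
      exact ht j hj
    rcases lt_or_gt_of_ne (hwne j hj) with hw | hw
    · rw [abs_of_neg hw, abs_lt] at h
      exact ⟨⟨fun _ => by linarith, fun _ => by linarith⟩, by intro; linarith⟩
    · rw [abs_of_pos hw, abs_lt] at h
      exact ⟨⟨fun _ => by linarith, fun _ => by linarith⟩, by intro; linarith⟩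
  have hmem : ∀ ε : ℝ, (fun j => w j + ε * t * z j) ∈ D := fun ε =>
    D.add_mem hwD (D.smul_mem (ε * t) hzD)
  have htz : 0 < t * z i₀ := mul_pos htpos hz0
  obtain ⟨u, huD, hu, huk⟩ : ∃ u ∈ D, (∀ i, u i ≠ 0) ∧ #{i | 0 < u i} ≠ k := by
    by_cases hP : #{i | 0 < w i} = k
    · refine ⟨_, hmem 1, fun j => ?_, ?_⟩
      · by_cases hj : j = i₀
        · subst hj
          simpa [hw0] using htz.ne'
        · exact (hsign 1 (by simp) j hj).2
      · have : ({i | 0 < w i + 1 * t * z i} : Finset ι) =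
            insert i₀ ({i | 0 < w i} : Finset ι) := by
          ext j
          by_cases hj : j = i₀
          · subst hj
            simpa [hw0] using htz
          · simp [hj, -one_mul, (hsign 1 (by simp) j hj).1]
        rw [this, card_insert_of_notMem (by simp [hw0])]
        omega
    · refine ⟨_, hmem (-1), fun j => ?_, ?_⟩
      · by_cases hj : j = i₀
        · subst hj
          simpa [hw0] using htz.ne'
        · exact (hsign (-1) (by simp) j hj).2
      · have : ({i | 0 < w i + -1 * t * z i} : Finset ι) = ({i | 0 < w i} : Finset ι) := by
          ext j
          by_cases hj : j = i₀
          · subst hj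
            simpa [hw0] using htz.le
          · simp [-neg_mul, (hsign (-1) (by simp) j hj).1]
        rwa [this]
  obtain ⟨u, huD, hu, huk⟩ : ∃ u ∈ D, (∀ i, u i ≠ 0) ∧ k < #{i | 0 < u i} := by
    rcases huk.lt_or_gt with h | h
    · refine ⟨-u, D.neg_mem huD, by simpa using hu, ?_⟩
      have hcard := card_filter_add_card_filter_not (s := (univ : Finset ι)) fun i => 0 < u i
      have hneg : ({i | 0 < (-u) i} : Finset ι) = ({i | ¬0 < u i} : Finset ι) := by
        ext i
        simp [(hu i).le_iff_lt]
      rw [hneg]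
      rw [card_univ] at hcard
      omega
    · exact ⟨u, huD, hu, h⟩
  refine ⟨u, fun i => -z i / u i, fun i j hij => ?_, huk, huD, ?_, hu, fun μ hμ => ?_⟩
  · by_contra hne
    set ρ : ℝ := -z i / u i with hρ
    have hi' : z i + ρ * u i = 0 := by
      rw [hρ]
      field_simp [hu i]
      ring
    have hj' : z j + ρ * u j = 0 := by
      rw [show ρ = -z j / u j from hij]
      field_simp [hu j]
      ring
    have h0 := hD' (z + ρ • u) (D.add_mem hzD (D.smul_mem ρ huD)) i j hne hi' hj'
    have h1 := congrFun h0 i₁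
    have h2 := congrFun h0 i₀
    simp only [Pi.add_apply, Pi.smul_apply, smul_eq_mul, Pi.zero_apply, hz1, zero_add,
      mul_eq_zero, hu i₁, or_false] at h1 h2
    rw [h1] at h2
    linarith
  · convert D.neg_mem hzD using 1
    ext i
    simp [mul_div_cancel₀ _ (hu i)]
  · set α : ℝ := μ i₁ / u i₁ with hα
    set β : ℝ := (μ i₀ - α * u i₀) / z i₀ with hβ
    refine ⟨α, β, fun i => ?_⟩
    have h0 := hD' (μ - (α • u + β • z))
      (D.sub_mem hμ (D.add_mem (D.smul_mem α huD) (D.smul_mem β hzD))) i₀ i₁ hi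
      (by simp [hβ, hz0.ne']) (by simp [hz1, hα, hu i₁])
    have h1 := congrFun h0 i
    simp only [Pi.sub_apply, Pi.add_apply, Pi.smul_apply, smul_eq_mul, Pi.zero_apply] at h1
    have := hu i
    field_simp
    linarith

end Dependencies

section Linking

open Finset

variable {ι E : Type*} [Fintype ι] [DecidableEq ι] [NormedAddCommGroup E] [NormedSpace ℝ E]
  [FiniteDimensional ℝ E]

lemma exists_intrinsicFrontier_inter_intrinsicInterior_eq_singleton_s2 {A : ι → E} {u r : ι → ℝ}
    (hr : r.Injective) (hu : ∀ i, u i ≠ 0) (huD : u ∈ affineDependencies A)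
    (hurD : u * r ∈ affineDependencies A)
    (hspan : ∀ μ ∈ affineDependencies A, ∃ α β : ℝ, ∀ i, μ i = u i * (α - β * r i))
    {a b : ι} (hab : r a < r b) (hcons : ∀ c, r c ≤ r a ∨ r b ≤ r c) (ha : 0 < u a) (hb : 0 < u b)
    {s : Finset ι} (hs : ∀ i, i ∈ s ↔ (r i ≤ r a ↔ 0 < u i))
    (hsA : AffineIndependent ℝ fun i : s => A i)
    (htA : AffineIndependent ℝ fun i : (sᶜ : Finset ι) => A i) :
    ∃ p, intrinsicFrontier ℝ (convexHull ℝ (A '' (s : Set ι))) ∩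
      intrinsicInterior ℝ (convexHull ℝ (A '' ((sᶜ : Finset ι) : Set ι))) = {p} := by
  have has : a ∈ s := (hs a).2 (by simp [ha])
  have hbs : b ∈ sᶜ := by
    rw [mem_compl, hs]
    simp [hb, hab]
  -- the dependency of the pencil that vanishes at `a`
  let l : ι → ℝ := fun i => u i * (r a - r i)
  have hlD : l ∈ affineDependencies A := by
    convert (affineDependencies A).sub_mem ((affineDependencies A).smul_mem (r a) huD) hurD using 1
    ext i
    simp only [l, Pi.sub_apply, Pi.smul_apply, Pi.mul_apply, smul_eq_mul]
    ring
  have hl_nonneg : ∀ i ∈ s, 0 ≤ l i := by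
    intro i hi
    rcases le_or_gt (r i) (r a) with h | h
    · exact mul_nonneg (((hs i).1 hi).1 h).le (sub_nonneg.2 h)
    · exact mul_nonneg_of_nonpos_of_nonpos
        (not_lt.1 fun h' => h.not_ge (((hs i).1 hi).2 h')) (sub_nonpos.2 h.le)
  have hl_neg : ∀ i ∈ sᶜ, l i < 0 := by
    intro i hi
    rw [mem_compl, hs] at hi
    have hne : r i ≠ r a := fun h => by
      rw [hr h] at hi
      simp [ha] at hi
    rcases lt_or_gt_of_ne hne with h | h
    · have : u i < 0 := (hu i).lt_of_le (not_lt.1 fun h' => hi ⟨fun _ => h', fun _ => h.le⟩)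
      exact mul_neg_of_neg_of_pos this (sub_pos.2 h)
    · have : 0 < u i := by
        by_contra h'
        exact hi ⟨fun h'' => absurd h'' h.not_ge, fun h'' => absurd h'' h'⟩
      exact mul_neg_of_pos_of_neg this (sub_neg.2 h)
  rw [mem_affineDependencies, ← sum_add_sum_compl s, ← sum_add_sum_compl s] at hlD
  set m : ℝ := ∑ i ∈ s, l i with hm
  have hmpos : 0 < m := by
    have : ∑ i ∈ sᶜ, l i < 0 := sum_neg hl_neg ⟨b, hbs⟩
    linarith [hlD.2]
  refine ⟨m⁻¹ • ∑ i ∈ s, l i • A i, Set.eq_singleton_iff_unique_mem.2 ⟨⟨?_, ?_⟩, ?_⟩⟩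
  · refine (mem_intrinsicFrontier_convexHull_image_iff hsA).2
      ⟨fun i => m⁻¹ * l i, fun i hi => mul_nonneg (inv_nonneg.2 hmpos.le) (hl_nonneg i hi),
        ⟨a, has, by simp [l]⟩, ?_, ?_⟩
    · rw [← mul_sum, inv_mul_cancel₀ hmpos.ne']
    · simp only [mul_smul, smul_sum]
  · refine (mem_intrinsicInterior_convexHull_image_iff htA).2
      ⟨fun i => m⁻¹ * -l i, fun i hi => mul_pos (inv_pos.2 hmpos) (neg_pos.2 (hl_neg i hi)), ?_, ?_⟩
    · rw [← mul_sum, sum_neg_distrib, ← eq_neg_of_add_eq_zero_left hlD.2, inv_mul_cancel₀ hmpos.ne']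
    · rw [eq_neg_of_add_eq_zero_left hlD.1]
      simp only [mul_smul, neg_smul, ← smul_sum, sum_neg_distrib]
  · rintro q ⟨hqs, hqt⟩
    obtain ⟨v, hv0, ⟨c, hcs, hvc⟩, hv1, hvq⟩ :=
      (mem_intrinsicFrontier_convexHull_image_iff hsA).1 hqs
    obtain ⟨w, hw0, hw1, hwq⟩ := (mem_intrinsicInterior_convexHull_image_iff htA).1 hqt
    let μ : ι → ℝ := fun i => if i ∈ s then v i else -w i
    have hμs : ∀ i ∈ s, μ i = v i := fun i hi => if_pos hi
    have hμt : ∀ i ∈ sᶜ, μ i = -w i := fun i hi => if_neg (mem_compl.1 hi)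
    have hμD : μ ∈ affineDependencies A := by
      rw [mem_affineDependencies, ← sum_add_sum_compl s, ← sum_add_sum_compl s,
        sum_congr rfl hμs, sum_congr rfl hμt,
        sum_congr rfl fun i hi => by rw [hμs i hi],
        sum_congr (s₁ := sᶜ) rfl fun i hi => by rw [hμt i hi, neg_smul],
        sum_neg_distrib, sum_neg_distrib, hv1, hw1, hvq, hwq]
      simp
    obtain ⟨α, β, hμ⟩ := hspan μ hμD
    have hα : α = β * r c := by
      have := hμ c
      rw [hμs c hcs, hvc, zero_eq_mul, or_iff_right (hu c)] at this
      linarith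
    subst hα
    have h1 : 0 ≤ β * (r c - r a) := by
      have h := hμ a
      rw [hμs a has] at h
      exact le_of_mul_le_mul_left (by rw [mul_zero, mul_sub, ← h]; exact hv0 a has) ha
    have h2 : β * (r c - r b) < 0 := by
      have h := hμ b
      rw [hμt b hbs] at h
      exact lt_of_mul_lt_mul_left
        (by rw [mul_zero, mul_sub, ← h]; exact neg_neg_of_pos (hw0 b hbs)) hb.le
    have hβ : 0 < β := by
      by_contra! h
      nlinarith
    have hca : r c = r a := by
      rcases hcons c with h | h
      · exact h.antisymm (sub_nonneg.1 (nonneg_of_mul_nonneg_right h1 hβ))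
      · nlinarith
    have hv : ∀ i ∈ s, v i = β * l i := fun i hi => by
      rw [← hμs i hi, hμ i, hca]
      ring
    have hβm : β * m = 1 := by rw [hm, mul_sum, ← sum_congr rfl hv, hv1]
    rw [← hvq, sum_congr rfl fun i hi => by rw [hv i hi, mul_smul], ← smul_sum,
      eq_inv_of_mul_eq_one_left hβm]

end Linking

lemma affineIndependent_of_card_le {ι E : Type*} [Fintype ι] [AddCommGroup E] [Module ℝ E]
    {A : ι → E} {d : ℕ} (hd : d ≤ Fintype.card ι)
    (hA : ∀ s : Finset ι, s.card = d → AffineIndependent ℝ fun i : s => A i)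
    {s : Finset ι} (hs : s.card ≤ d) : AffineIndependent ℝ fun i : s => A i := by
  obtain ⟨t, hst, ht⟩ := Finset.exists_superset_card_eq hs hd
  exact (hA t ht).comp_embedding ⟨fun i : s => (⟨i, hst i.2⟩ : t), fun i j h =>
    Subtype.ext (congrArg (fun x : t => (x : ι)) h)⟩

lemma eq_zero_of_mem_affineDependencies {ι E : Type*} [Fintype ι] [AddCommGroup E] [Module ℝ E]
    {A : ι → E} {s : Finset ι} (hs : AffineIndependent ℝ fun i : s => A i) {μ : ι → ℝ}
    (hμ : μ ∈ affineDependencies A) (h0 : ∀ i ∉ s, μ i = 0) : μ = 0 := by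
  rw [mem_affineDependencies, ← Finset.sum_subset s.subset_univ fun i _ hi => by simp [h0 i hi],
    ← Finset.sum_subset s.subset_univ fun i _ hi => h0 i hi] at hμ
  funext i
  by_cases hi : i ∈ s
  · rw [← Finset.sum_coe_sort, ← Finset.sum_coe_sort s μ] at hμ
    exact hs.eq_zero_of_sum_eq_zero (w := fun i : s => μ i) hμ.2 hμ.1 ⟨i, hi⟩
      (Finset.mem_univ _)
  · exact h0 i hi


/-- Linear Conway–Gordon–Sachs theorem (odd case): given `n + 3` points in
general position in ℝⁿ with `n` odd, there are two disjoint subsets of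
`(n + 3) / 2` points each whose convex hulls (which are `(n+1)/2`-dimensional
simplices) are linked: the intrinsic frontier of the first convex hull meets
the intrinsic interior of the second in exactly one point. -/
theorem linear_conway_gordon_sachs
    (n : ℕ) (hn : 0 < n) (hodd : Odd n)
    (A : Fin (n + 3) → EuclideanSpace ℝ (Fin n))
    (hgen : ∀ s : Finset (Fin (n + 3)), s.card = n + 1 →
      AffineIndependent ℝ (fun i : s => A i)) :
    ∃ s t : Finset (Fin (n + 3)),
      s.card = (n + 3) / 2 ∧ t.card = (n + 3) / 2 ∧ Disjoint s t ∧
      ∃ p : EuclideanSpace ℝ (Fin n),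
        intrinsicFrontier ℝ (convexHull ℝ (A '' (s : Set (Fin (n + 3))))) ∩
          intrinsicInterior ℝ (convexHull ℝ (A '' (t : Set (Fin (n + 3))))) = {p} := by
  obtain ⟨k, hk⟩ : ∃ k, n + 3 = 2 * k := by
    obtain ⟨j, rfl⟩ := hodd
    exact ⟨j + 2, by ring⟩
  have hind : ∀ s : Finset (Fin (n + 3)), s.card = k → AffineIndependent ℝ fun i : s => A i :=
    fun s hs => affineIndependent_of_card_le (by simp) hgen (by omega)
  obtain ⟨u, r, hr, huk, huD, hurD, hu, hspan⟩ :=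
    exists_unbalanced_pencil (by simpa using hk) (zero_ne_one (α := Fin (n + 3)))
      (affineDependencies A)
      (exists_mem_affineDependencies_apply_eq_zero A (by simp))
      (fun μ hμ i j hij hi hj => by
        refine eq_zero_of_mem_affineDependencies (s := {i, j}ᶜ) (hgen _ ?_) hμ fun c hc => ?_
        · rw [Finset.card_compl, Finset.card_pair hij, Fintype.card_fin]
          omega
        · simp only [Finset.mem_compl, not_not, Finset.mem_insert, Finset.mem_singleton] at hc
          rcases hc with rfl | rfl
          exacts [hi, hj])
  obtain ⟨a, b, hab, hcons, ha, hb, hcard⟩ := exists_balanced_cut hk hr (fun i => 0 < u i) huk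
  set s : Finset (Fin (n + 3)) := {i | r i ≤ r a ↔ 0 < u i} with hs
  have hcompl : sᶜ.card = k := by
    rw [Finset.card_compl, hcard, Fintype.card_fin]
    omega
  exact ⟨s, sᶜ, by omega, by omega, disjoint_compl_right,
    exists_intrinsicFrontier_inter_intrinsicInterior_eq_singleton_s2 hr hu huD hurD hspan hab hcons
      ha hb (by simp [hs]) (hind s hcard) (hind _ hcompl)⟩
end

section
/- Let n be an even positive integer and let A₁,…,A_{n+3} be n+3 points in general position in ℝⁿ. Then there exist two disjoint subsets of these points, each consisting of (n+2)/2 points, such that the intrinsic interiors of the convex hulls of the two subsets intersect, i.e., there is a point lying in the intrinsic interior of both convex hulls. -/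
/-- A convex combination with positive weights of finitely many points lies in the intrinsic
interior of their convex hull. -/
theorem sum_smul_mem_intrinsicInterior_convexHull {ι E : Type*} [Fintype ι]
    [NormedAddCommGroup E] [NormedSpace ℝ E] (A : ι → E) (w : ι → ℝ)
    (hw : ∀ i, 0 < w i) (hw1 : ∑ i, w i = 1) :
    ∑ i, w i • A i ∈ intrinsicInterior ℝ (convexHull ℝ (Set.range A)) := by
  classical
  set p := ∑ i, w i • A i with hp
  have hpmem : p ∈ convexHull ℝ (Set.range A) :=
    (convex_convexHull ℝ _).sum_mem (fun i _ => (hw i).le) hw1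
      fun i _ => subset_convexHull ℝ _ ⟨i, rfl⟩
  let L : (ι → ℝ) →ₗ[ℝ] E := Fintype.linearCombination ℝ fun i => A i - p
  have hL (c : ι → ℝ) : L c = ∑ i, c i • (A i - p) := rfl
  have hdir : vectorSpan ℝ (Set.range A) ≤ LinearMap.range L := by
    rw [vectorSpan_def, Submodule.span_le]
    rintro _ ⟨_, ⟨i, rfl⟩, _, ⟨j, rfl⟩, rfl⟩
    refine ⟨Pi.single i 1 - Pi.single j 1, ?_⟩
    simp [L, map_sub, Fintype.linearCombination_apply_single]
  obtain ⟨g, hg⟩ := L.rangeRestrict.exists_rightInverse_of_surjective L.range_rangeRestrict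
  have hgL (y : LinearMap.range L) : L (g y) = y :=
    congrArg Subtype.val (LinearMap.congr_fun hg y)
  have hgc : Continuous g := g.continuous_of_finiteDimensional
  set S := affineSpan ℝ (convexHull ℝ (Set.range A)) with hS
  have hpS : p ∈ S := subset_affineSpan ℝ _ hpmem
  have hsub (q : S) : (q : E) - p ∈ LinearMap.range L := by
    apply hdir
    have := AffineSubspace.vsub_mem_direction q.2 hpS
    have hSdir : S.direction = vectorSpan ℝ (Set.range A) := by
      rw [hS, affineSpan_convexHull, direction_affineSpan]
    rwa [hSdir] at this
  let c : S → ι → ℝ := fun q => g ⟨q - p, hsub q⟩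
  have hc : Continuous c :=
    hgc.comp ((continuous_subtype_val.sub continuous_const).subtype_mk _)
  have hqc (q : S) : (q : E) = p + ∑ i, c q i • (A i - p) := by
    rw [← hL, hgL]; simp
  have hcp : c ⟨p, hpS⟩ = 0 := by
    simp only [c, sub_self]
    exact map_zero g
  refine mem_intrinsicInterior.2 ⟨⟨p, hpS⟩, mem_interior.2
    ⟨{q | ∀ i, 0 < w i * (1 - ∑ j, c q j) + c q i}, ?_, ?_, ?_⟩, rfl⟩
  · intro q hq
    have hq' : (q : E) = ∑ i, (w i * (1 - ∑ j, c q j) + c q i) • A i := by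
      rw [hqc q]
      simp only [add_smul, Finset.sum_add_distrib, smul_sub, Finset.sum_sub_distrib,
        mul_comm (w _), mul_smul, ← Finset.smul_sum, ← Finset.sum_smul, ← hp]
      module
    rw [Set.mem_preimage, hq']
    refine (convex_convexHull ℝ _).sum_mem (fun i _ => (hq i).le) ?_
      fun i _ => subset_convexHull ℝ _ ⟨i, rfl⟩
    rw [Finset.sum_add_distrib, ← Finset.sum_mul, hw1]
    ring
  · simp only [Set.ofPred_forall]
    refine isOpen_iInter_of_finite fun i => isOpen_lt continuous_const ?_
    fun_prop
  · intro i
    simpa [hcp] using hw i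

theorem odd_sum_range_of_sign (s : ℕ → ℤ) (hs : ∀ k, s k = 1 ∨ s k = -1) {m : ℕ} (hm : Odd m) :
    Odd (∑ k ∈ Finset.range m, s k) := by
  have h : ∀ m : ℕ, ∃ z : ℤ, ∑ k ∈ Finset.range m, s k = m + 2 * z := by
    intro m
    induction m with
    | zero => exact ⟨0, by simp⟩
    | succ m ih =>
      obtain ⟨z, hz⟩ := ih
      rw [Finset.sum_range_succ, hz]
      rcases hs m with h | h
      · exact ⟨z, by rw [h]; push_cast; ring⟩
      · exact ⟨z - 1, by rw [h]; push_cast; ring⟩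
  obtain ⟨z, hz⟩ := h m
  obtain ⟨r, rfl⟩ := hm
  exact ⟨r + z, by rw [hz]; push_cast; ring⟩

/-- A sequence of signs of odd length has a term such that the terms before it and the terms
after it have the same sum. -/
theorem exists_sum_range_add_sum_range_succ_eq (s : ℕ → ℤ) (hs : ∀ k, s k = 1 ∨ s k = -1)
    {m : ℕ} (hm : Odd m) :
    ∃ i < m, ∑ k ∈ Finset.range i, s k + ∑ k ∈ Finset.range (i + 1), s k =
      ∑ k ∈ Finset.range m, s k := by
  wlog hT : 0 < ∑ k ∈ Finset.range m, s k generalizing s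
  · obtain ⟨z, hz⟩ := odd_sum_range_of_sign s hs hm
    obtain ⟨i, hi, h⟩ := this (fun k => -s k) (fun k => by have := hs k; omega)
      (by rw [Finset.sum_neg_distrib]; omega)
    refine ⟨i, hi, ?_⟩
    simp only [Finset.sum_neg_distrib] at h
    omega
  obtain ⟨z, hz⟩ := odd_sum_range_of_sign s hs hm
  have hlast : ∑ k ∈ Finset.range m, s k ≤
      ∑ k ∈ Finset.range (m - 1), s k + ∑ k ∈ Finset.range (m - 1 + 1), s k := by
    obtain ⟨r, rfl⟩ := hm
    have := hs (2 * r)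
    simp only [Nat.add_sub_cancel, Finset.sum_range_succ] at *
    omega
  have hex : ∃ i, ∑ k ∈ Finset.range m, s k ≤
      ∑ k ∈ Finset.range i, s k + ∑ k ∈ Finset.range (i + 1), s k := ⟨m - 1, hlast⟩
  classical
  refine ⟨Nat.find hex, ?_, ?_⟩
  · have := Nat.find_min' hex hlast
    have := hm.pos
    omega
  · have hge := Nat.find_spec hex
    have hlt : ∀ j < Nat.find hex, _ := fun j hj => Nat.find_min hex hj
    generalize Nat.find hex = i at hge hlt
    cases i with
    | zero =>
      have := hs 0
      simp only [Finset.sum_range_succ, Finset.sum_range_zero] at *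
      omega
    | succ i =>
      have h := hlt i i.lt_succ_self
      have := hs i
      have := hs (i + 1)
      simp only [Finset.sum_range_succ] at *
      omega

theorem sum_range_mul_sign_sub (s : ℕ → ℤ) {i m : ℕ} (hi : i < m) :
    ∑ k ∈ Finset.range m, s k * ((SignType.sign ((k : ℤ) - i) : SignType) : ℤ) =
      ∑ k ∈ Finset.range m, s k -
        (∑ k ∈ Finset.range i, s k + ∑ k ∈ Finset.range (i + 1), s k) := by
  induction m, hi using Nat.le_induction with
  | base =>
    have : ∑ k ∈ Finset.range i, s k * ((SignType.sign ((k : ℤ) - i) : SignType) : ℤ) =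
        ∑ k ∈ Finset.range i, -s k := by
      refine Finset.sum_congr rfl fun k hk => ?_
      have hk' : (k : ℤ) - i < 0 := by
        have := Finset.mem_range.1 hk
        omega
      simp [sign_neg hk']
    rw [Finset.sum_range_succ, this, Finset.sum_neg_distrib]
    simp
  | succ m hm ih =>
    have hm' : 0 < (m : ℤ) - i := by omega
    rw [Finset.sum_range_succ, ih, sign_pos hm', Finset.sum_range_succ _ m]
    simp
    ring

/-- Given an odd number of distinct reals `t j` with nonzero weights `u j`, there is an `i` such
that the signs of `u j * (t j - t i)` sum to zero. -/
theorem exists_sum_sign_mul_sub_eq_zero {m : ℕ} (hm : Odd m) (t u : Fin m → ℝ)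
    (ht : Function.Injective t) (hu : ∀ i, u i ≠ 0) :
    ∃ i, ∑ j, ((SignType.sign (u j * (t j - t i)) : SignType) : ℤ) = 0 := by
  set σ := Tuple.sort t
  have hmono : StrictMono (t ∘ σ) :=
    (Tuple.monotone_sort t).strictMono_of_injective (ht.comp σ.injective)
  let s : ℕ → ℤ := fun k =>
    if h : k < m then ((SignType.sign (u (σ ⟨k, h⟩)) : SignType) : ℤ) else 1
  have hs : ∀ k, s k = 1 ∨ s k = -1 := by
    intro k
    by_cases h : k < m
    · simp only [s, h, dif_pos]
      rcases (hu (σ ⟨k, h⟩)).lt_or_gt with h' | h'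
      · right; simp [sign_neg h']
      · left; simp [sign_pos h']
    · simp [s, h]
  obtain ⟨i, hi, h⟩ := exists_sum_range_add_sum_range_succ_eq s hs hm
  refine ⟨σ ⟨i, hi⟩, ?_⟩
  have hsum := sum_range_mul_sign_sub s hi
  rw [h, sub_self, Finset.sum_range] at hsum
  rw [← hsum, ← Equiv.sum_comp σ]
  refine Finset.sum_congr rfl fun k _ => ?_
  have hsign : SignType.sign (t (σ k) - t (σ ⟨i, hi⟩)) = SignType.sign ((k : ℤ) - i) := by
    rcases lt_trichotomy (k : ℕ) i with hk | hk | hk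
    · rw [sign_neg (sub_neg.2 (show t (σ k) < t (σ ⟨i, hi⟩) from hmono hk)), sign_neg (by omega)]
    · obtain rfl : k = ⟨i, hi⟩ := Fin.ext hk
      simp
    · rw [sign_pos (sub_pos.2 (show t (σ ⟨i, hi⟩) < t (σ k) from hmono hk)), sign_pos (by omega)]
  rw [sign_mul, hsign]
  simp [s]

/-- A family whose signs sum to zero has as many positive as negative entries. -/
theorem card_filter_pos_eq_card_filter_neg {ι : Type*} [Fintype ι] (f : ι → ℝ)
    (h : ∑ j, ((SignType.sign (f j) : SignType) : ℤ) = 0) :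
    (Finset.univ.filter fun j => 0 < f j).card = (Finset.univ.filter fun j => f j < 0).card := by
  have key : ∀ x : ℝ, ((SignType.sign x : SignType) : ℤ) =
      (if 0 < x then 1 else 0) - (if x < 0 then 1 else 0) := by
    intro x
    rcases lt_trichotomy x 0 with hx | rfl | hx
    · simp [hx, hx.not_gt]
    · simp
    · simp [hx, hx.not_gt]
  simp only [key, Finset.sum_sub_distrib, Finset.sum_boole] at h
  omega

/-- If any `n + 1` of `n + 3` points are affinely independent, an affine dependence of these points
with two zero coefficients is trivial. -/
theorem eq_zero_of_affine_dependence {n : ℕ} {E : Type*} [AddCommGroup E] [Module ℝ E]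
    (A : Fin (n + 3) → E)
    (hgen : ∀ s : Finset (Fin (n + 3)), s.card = n + 1 →
      AffineIndependent ℝ (fun i : s => A i))
    (w : Fin (n + 3) → ℝ) (hw : ∑ i, w i = 0) (hwA : ∑ i, w i • A i = 0)
    {i j : Fin (n + 3)} (hij : i ≠ j) (hi : w i = 0) (hj : w j = 0) : w = 0 := by
  set s : Finset (Fin (n + 3)) := (Finset.univ.erase i).erase j with hs
  have hcard : s.card = n + 1 := by
    rw [hs, Finset.card_erase_of_mem (by simp [hij.symm]), Finset.card_erase_of_mem (by simp)]
    simp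
  have hout : ∀ k, k ∉ s → w k = 0 := by
    intro k hk
    by_cases hki : k = i
    · rw [hki, hi]
    · by_cases hkj : k = j
      · rw [hkj, hj]
      · simp [hs, hki, hkj] at hk
  have h := (hgen s hcard).eq_zero_of_sum_eq_zero (s := Finset.univ) (w := fun k : s => w k)
    (by
      rw [Finset.sum_coe_sort s w, ← hw]
      exact Finset.sum_subset (Finset.subset_univ _) fun k _ hk => hout k hk)
    (by
      rw [Finset.sum_coe_sort s fun k => w k • A k, ← hwA]
      exact Finset.sum_subset (Finset.subset_univ _) fun k _ hk => by rw [hout k hk, zero_smul])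
  funext k
  by_cases hk : k ∈ s
  · exact h ⟨k, hk⟩ (Finset.mem_univ _)
  · exact hout k hk

theorem sum_filter_pos_smul_eq_sum_filter_neg {ι F : Type*} [Fintype ι] [AddCommGroup F]
    [Module ℝ F] (w : ι → ℝ) (B : ι → F) (h : ∑ i, w i • B i = 0) :
    ∑ i with 0 < w i, w i • B i = ∑ i with w i < 0, (-w i) • B i := by
  have h1 : ∑ i, w i • B i =
      ∑ i with 0 < w i, w i • B i + ∑ i with w i < 0, w i • B i := by
    rw [Finset.sum_filter, Finset.sum_filter, ← Finset.sum_add_distrib]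
    refine Finset.sum_congr rfl fun i _ => ?_
    rcases lt_trichotomy (w i) 0 with hx | hx | hx
    · simp [hx, hx.not_gt]
    · simp [hx]
    · simp [hx, hx.not_gt]
  simp only [neg_smul, Finset.sum_neg_distrib]
  rw [← add_eq_zero_iff_eq_neg, ← h1, h]

/-- The positive and the negative part of an affine dependence give a common point of the intrinsic
interiors of the corresponding convex hulls. -/
theorem exists_mem_intrinsicInterior_of_affine_dependence {ι E : Type*} [Fintype ι]
    [NormedAddCommGroup E] [NormedSpace ℝ E] (A : ι → E) (w : ι → ℝ)
    (hw : ∑ i, w i = 0) (hwA : ∑ i, w i • A i = 0) (hne : ∃ i, 0 < w i) :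
    ∃ p : E,
      p ∈ intrinsicInterior ℝ (convexHull ℝ
        (A '' ((Finset.univ.filter fun i => 0 < w i : Finset ι) : Set ι))) ∧
      p ∈ intrinsicInterior ℝ (convexHull ℝ
        (A '' ((Finset.univ.filter fun i => w i < 0 : Finset ι) : Set ι))) := by
  classical
  set s := Finset.univ.filter fun i => 0 < w i with hs
  set t := Finset.univ.filter fun i => w i < 0 with ht
  have key (r : Finset ι) (v : ι → ℝ) (hv : ∀ i ∈ r, 0 < v i) (c : ℝ) (hc : 0 < c)
      (hvc : ∑ i ∈ r, v i = c) :
      c⁻¹ • ∑ i ∈ r, v i • A i ∈ intrinsicInterior ℝ (convexHull ℝ (A '' (r : Set ι))) := by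
    have h := sum_smul_mem_intrinsicInterior_convexHull (fun i : r => A i) (fun i => c⁻¹ * v i)
      (fun i => mul_pos (inv_pos.2 hc) (hv i i.2))
      (by rw [← Finset.mul_sum, Finset.sum_coe_sort r v, hvc, inv_mul_cancel₀ hc.ne'])
    rw [Finset.sum_coe_sort r fun i => (c⁻¹ * v i) • A i] at h
    simp only [mul_smul, ← Finset.smul_sum] at h
    rw [Set.image_eq_range]
    exact h
  have hsum : ∑ i ∈ s, w i = ∑ i ∈ t, -w i := by
    simpa [hs, ht] using
      sum_filter_pos_smul_eq_sum_filter_neg w (fun _ => (1 : ℝ)) (by simpa using hw)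
  have hpos : ∀ i ∈ s, 0 < w i := fun i hi => (Finset.mem_filter.1 hi).2
  have hc : 0 < ∑ i ∈ s, w i := by
    obtain ⟨i, hi⟩ := hne
    exact Finset.sum_pos hpos ⟨i, by simp [hs, hi]⟩
  refine ⟨(∑ i ∈ s, w i)⁻¹ • ∑ i ∈ s, w i • A i, key s w hpos _ hc rfl, ?_⟩
  rw [sum_filter_pos_smul_eq_sum_filter_neg w A hwA]
  exact key t (fun i => -w i) (fun i hi => neg_pos.2 (Finset.mem_filter.1 hi).2) _ hc hsum.symm

/-- For `n + 3` points in general position in an `n`-dimensional space there are affine dependences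
`u` and `t * u` with `u` nowhere zero and `t` injective. -/
theorem exists_affine_dependence_pair {n : ℕ} {E : Type*} [AddCommGroup E] [Module ℝ E]
    [FiniteDimensional ℝ E] (hE : Module.finrank ℝ E = n) (A : Fin (n + 3) → E)
    (hgen : ∀ s : Finset (Fin (n + 3)), s.card = n + 1 →
      AffineIndependent ℝ (fun i : s => A i)) :
    ∃ u t : Fin (n + 3) → ℝ, (∀ i, u i ≠ 0) ∧ Function.Injective t ∧
      ∑ i, u i = 0 ∧ ∑ i, u i • A i = 0 ∧
      ∑ i, u i * t i = 0 ∧ ∑ i, (u i * t i) • A i = 0 := by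
  let L : (Fin (n + 3) → ℝ) →ₗ[ℝ] ℝ × E :=
    Fintype.linearCombination ℝ fun i => ((1 : ℝ), A i)
  have hL (w) : L w = 0 ↔ ∑ i, w i = 0 ∧ ∑ i, w i • A i = 0 := by
    simp [L, Fintype.linearCombination_apply, Prod.ext_iff, Prod.fst_sum, Prod.snd_sum]
  have hdim : 1 < Module.finrank ℝ (LinearMap.ker L) := by
    have h1 := L.finrank_range_add_finrank_ker
    have h2 := (LinearMap.range L).finrank_le
    simp only [Module.finrank_prod, Module.finrank_self, hE, Module.finrank_fin_fun] at h1 h2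
    omega
  have : Nontrivial (LinearMap.ker L) := Module.nontrivial_of_finrank_pos (R := ℝ) (by omega)
  obtain ⟨x, hx⟩ := exists_ne (0 : LinearMap.ker L)
  obtain ⟨y, hxy⟩ := exists_linearIndependent_pair_of_one_lt_finrank hdim hx
  rw [LinearIndependent.pair_iff] at hxy
  have hcomb (a b : ℝ) {i j : Fin (n + 3)} (hij : i ≠ j)
      (hi : a * x.1 i + b * y.1 i = 0) (hj : a * x.1 j + b * y.1 j = 0) : a = 0 ∧ b = 0 := by
    refine hxy a b (Subtype.ext ?_)
    have hmem := (hL _).1 (a • x + b • y).2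
    exact eq_zero_of_affine_dependence A hgen _ hmem.1 hmem.2 hij hi hj
  obtain ⟨c, hc⟩ := Infinite.exists_notMem_finset
    (Finset.univ.image fun i => -(x.1 i / y.1 i))
  have hu (i) : x.1 i + c * y.1 i ≠ 0 := by
    intro h
    by_cases hy : y.1 i = 0
    · have hx0 : x.1 i = 0 := by simpa [hy] using h
      obtain ⟨j, hj⟩ := exists_ne i
      obtain ⟨hyj, hxj⟩ := hcomb (y.1 j) (-x.1 j) hj.symm (by simp [hx0, hy]) (by ring)
      have := hcomb 1 0 hj.symm (by simp [hx0]) (by simpa using hxj)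
      exact one_ne_zero this.1
    · refine hc (Finset.mem_image.2 ⟨i, Finset.mem_univ i, ?_⟩)
      field_simp
      linarith
  have hmul (i) : (x.1 i + c * y.1 i) * (y.1 i / (x.1 i + c * y.1 i)) = y.1 i :=
    mul_div_cancel₀ _ (hu i)
  have hmemu := (hL _).1 (x + c • y).2
  have hmemy := (hL _).1 y.2
  refine ⟨fun i => x.1 i + c * y.1 i, fun i => y.1 i / (x.1 i + c * y.1 i), hu, ?_,
    hmemu.1, hmemu.2, by simpa only [hmul] using hmemy.1, by simpa only [hmul] using hmemy.2⟩
  intro i j hij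
  by_contra hne
  dsimp only at hij
  have hj := hmul j
  rw [← hij] at hj
  have hi := hmul i
  generalize y.1 i / (x.1 i + c * y.1 i) = r at hi hj
  obtain ⟨hr, hr'⟩ := hcomb (-r) (1 - r * c) hne (by linarith) (by linarith)
  rw [neg_eq_zero.1 hr] at hr'
  simp at hr'

/-- Linear van Kampen–Flores theorem (even case): given `n + 3` points in
general position in ℝⁿ with `n` even, there are two disjoint subsets of
`(n + 2) / 2` points each such that the intrinsic interiors of their convex
hulls intersect. -/
theorem linear_van_kampen_flores
    (n : ℕ) (hn : 0 < n) (heven : Even n)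
    (A : Fin (n + 3) → EuclideanSpace ℝ (Fin n))
    (hgen : ∀ s : Finset (Fin (n + 3)), s.card = n + 1 →
      AffineIndependent ℝ (fun i : s => A i)) :
    ∃ s t : Finset (Fin (n + 3)),
      s.card = (n + 2) / 2 ∧ t.card = (n + 2) / 2 ∧ Disjoint s t ∧
      ∃ p : EuclideanSpace ℝ (Fin n),
        p ∈ intrinsicInterior ℝ (convexHull ℝ (A '' (s : Set (Fin (n + 3))))) ∧
        p ∈ intrinsicInterior ℝ (convexHull ℝ (A '' (t : Set (Fin (n + 3))))) := by
  obtain ⟨u, t, hu, ht, hu0, huA, hut0, hutA⟩ :=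
    exists_affine_dependence_pair finrank_euclideanSpace_fin A hgen
  obtain ⟨i, hi⟩ := exists_sum_sign_mul_sub_eq_zero (heven.add_odd (by decide)) t u ht hu
  set w : Fin (n + 3) → ℝ := fun j => u j * (t j - t i) with hw
  have hw0 : ∑ j, w j = 0 := by
    simp only [hw, mul_sub, Finset.sum_sub_distrib, ← Finset.sum_mul, hut0, hu0]
    simp
  have hwA : ∑ j, w j • A j = 0 := by
    have hwj (j) : w j • A j = (u j * t j) • A j - t i • u j • A j := by
      rw [smul_smul, ← sub_smul, mul_comm (t i), ← mul_sub]
    simp only [hwj, Finset.sum_sub_distrib, hutA, ← Finset.smul_sum, huA]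
    simp
  have hcard := card_filter_pos_eq_card_filter_neg w hi
  have hdisj : Disjoint (Finset.univ.filter fun j => 0 < w j)
      (Finset.univ.filter fun j => w j < 0) :=
    Finset.disjoint_filter.2 fun j _ h => h.not_gt
  have hunion : (Finset.univ.filter fun j => 0 < w j) ∪ (Finset.univ.filter fun j => w j < 0) =
      Finset.univ.erase i := by
    ext j
    have : w j = 0 ↔ j = i := by simp [hw, hu j, sub_eq_zero, ht.eq_iff]
    simp only [Finset.mem_union, Finset.mem_filter, Finset.mem_univ, true_and, Finset.mem_erase,
      and_true, ne_eq, ← this]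
    exact or_comm.trans lt_or_lt_iff_ne
  have htotal := Finset.card_union_of_disjoint hdisj
  rw [hunion, Finset.card_erase_of_mem (Finset.mem_univ i), Finset.card_univ,
    Fintype.card_fin] at htotal
  have hne : ∃ j, 0 < w j := by
    obtain ⟨j, hj⟩ := Finset.card_pos.1
      (show 0 < (Finset.univ.filter fun j => 0 < w j).card by omega)
    exact ⟨j, (Finset.mem_filter.1 hj).2⟩
  exact ⟨_, _, by omega, by omega, hdisj,
    exists_mem_intrinsicInterior_of_affine_dependence A w hw0 hwA hne⟩
end

section
/- Let n be a positive integer, let A₁,…,A_{n+3} be n+3 points in general position in ℝⁿ, and fix an index i ∈ {1,…,n+3}. Then the set of vectors x = (x₁,…,x_{n+3}) ∈ ℝ^{n+3} satisfying ∑ⱼ xⱼ Aⱼ = 0, ∑ⱼ xⱼ = 0 and xᵢ = 0 is a linear subspace of ℝ^{n+3} of dimension exactly 1; moreover, for distinct indices i ≠ j these one-dimensional subspaces (lines) ℓᵢ and ℓⱼ are distinct. -/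
/-- The linear map whose kernel is the solution space of `∑ⱼ xⱼ Aⱼ = 0`, `∑ⱼ xⱼ = 0`, `xᵢ = 0`. -/
def solutionMap {ι E : Type*} [Fintype ι] [AddCommGroup E] [Module ℝ E] (A : ι → E) (i : ι) :
    (ι → ℝ) →ₗ[ℝ] E × ℝ × ℝ :=
  (Fintype.linearCombination ℝ A).prod
    ((Fintype.linearCombination ℝ fun _ : ι => (1 : ℝ)).prod (LinearMap.proj i))

theorem mem_ker_solutionMap {ι E : Type*} [Fintype ι] [AddCommGroup E] [Module ℝ E]
    {A : ι → E} {i : ι} {x : ι → ℝ} :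
    x ∈ LinearMap.ker (solutionMap A i) ↔ ∑ j, x j • A j = 0 ∧ ∑ j, x j = 0 ∧ x i = 0 := by
  simp [solutionMap, Fintype.linearCombination_apply]

/-- An affine dependence supported on an affinely independent subfamily is trivial. -/
theorem eq_zero_of_affineIndependent_subfamily {ι E : Type*} [Fintype ι]
    [AddCommGroup E] [Module ℝ E] {A : ι → E} {s : Finset ι}
    (hs : AffineIndependent ℝ (fun i : s => A i)) {x : ι → ℝ}
    (hA : ∑ j, x j • A j = 0) (h1 : ∑ j, x j = 0) (hx : ∀ j ∉ s, x j = 0) : x = 0 := by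
  have h1' : ∑ j ∈ s, x j = 0 := by
    rw [← h1]
    exact Finset.sum_subset (Finset.subset_univ s) fun j _ hj => hx j hj
  have hA' : ∑ j ∈ s, x j • A j = 0 := by
    rw [← hA]
    exact Finset.sum_subset (Finset.subset_univ s) fun j _ hj => by rw [hx j hj, zero_smul]
  rw [← Finset.sum_coe_sort] at h1' hA'
  funext j
  by_cases hj : j ∈ s
  · exact affineIndependent_iff.1 hs Finset.univ (fun k : s => x k) h1' hA' ⟨j, hj⟩
      (Finset.mem_univ _)
  · exact hx j hj

/-- For `n + 3` points in general position in ℝⁿ and each index `i`, the set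
`ℓᵢ` of solutions of `∑ⱼ xⱼ Aⱼ = 0`, `∑ⱼ xⱼ = 0`, `xᵢ = 0` is a linear
subspace of ℝ^{n+3} of dimension exactly `1`; moreover, these lines are
pairwise distinct. -/
theorem solution_lines_dim_one_and_distinct
    (n : ℕ) (hn : 0 < n)
    (A : Fin (n + 3) → EuclideanSpace ℝ (Fin n))
    (hgen : ∀ s : Finset (Fin (n + 3)), s.card = n + 1 →
      AffineIndependent ℝ (fun i : s => A i))
    (L : Fin (n + 3) → Set (Fin (n + 3) → ℝ))
    (hL : ∀ i, L i = {x | (∑ j, x j • A j = 0) ∧ (∑ j, x j = 0) ∧ x i = 0}) :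
    (∀ i, ∃ S : Submodule ℝ (Fin (n + 3) → ℝ),
      (S : Set (Fin (n + 3) → ℝ)) = L i ∧ Module.finrank ℝ S = 1) ∧
    (∀ i j, i ≠ j → L i ≠ L j) := by
  have key : ∀ i j, i ≠ j → ∀ x ∈ LinearMap.ker (solutionMap A i), x j = 0 → x = 0 := by
    intro i j hij x hx hxj
    obtain ⟨hA, h1, hxi⟩ := mem_ker_solutionMap.1 hx
    have hcard : (({i, j} : Finset (Fin (n + 3)))ᶜ).card = n + 1 := by
      rw [Finset.card_compl, Finset.card_pair hij, Fintype.card_fin]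
      omega
    refine eq_zero_of_affineIndependent_subfamily (hgen _ hcard) hA h1 fun k hk => ?_
    have hk' : k = i ∨ k = j := by simpa [or_iff_not_imp_left] using hk
    rcases hk' with rfl | rfl
    · exact hxi
    · exact hxj
  have hcoe : ∀ i, (LinearMap.ker (solutionMap A i) : Set (Fin (n + 3) → ℝ)) = L i := by
    intro i
    rw [hL i]
    ext x
    exact mem_ker_solutionMap
  have hdim : ∀ i, Module.finrank ℝ (LinearMap.ker (solutionMap A i)) = 1 := by
    intro i
    apply le_antisymm
    · obtain ⟨j, hji⟩ := exists_ne i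
      have hinj : Function.Injective
          ((LinearMap.proj j : (Fin (n + 3) → ℝ) →ₗ[ℝ] ℝ).domRestrict
            (LinearMap.ker (solutionMap A i))) := by
        rw [injective_iff_map_eq_zero]
        intro x hx
        exact Subtype.ext (key i j hji.symm x x.2 hx)
      simpa using LinearMap.finrank_le_finrank_of_injective hinj
    · have hrank := (solutionMap A i).finrank_range_add_finrank_ker
      have hrange := (LinearMap.range (solutionMap A i)).finrank_le
      simp only [Module.finrank_prod, finrank_euclideanSpace_fin, Module.finrank_self,
        Module.finrank_fin_fun] at hrank hrange
      omega
  refine ⟨fun i => ⟨_, hcoe i, hdim i⟩, fun i j hij hLij => ?_⟩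
  have hker : LinearMap.ker (solutionMap A i) = ⊥ := by
    refine (Submodule.eq_bot_iff _).2 fun x hx => key i j hij x hx ?_
    have hxj : x ∈ L j := by
      rw [← hLij, ← hcoe i]
      exact hx
    rw [hL j] at hxj
    exact hxj.2.2
  have h := hdim i
  rw [hker, finrank_bot] at h
  exact zero_ne_one h
end

section
/- Let n be an even positive integer and let A₁,…,A_{n+3} be n+3 points in general position in ℝⁿ. Then there exists a nonzero vector x̂ = (x̂₁,…,x̂_{n+3}) ∈ ℝ^{n+3} with ∑ᵢ x̂ᵢ Aᵢ = 0 and ∑ᵢ x̂ᵢ = 0 that has exactly (n+2)/2 strictly positive coordinates and exactly (n+2)/2 strictly negative coordinates (and hence exactly one zero coordinate). -/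
/-- A sum of an odd number of odd integers is odd. -/
theorem Int.odd_sum_univ_of_odd {ι : Type*} [Fintype ι] (f : ι → ℤ) (hf : ∀ i, Odd (f i))
    (hcard : Odd (Fintype.card ι)) : Odd (∑ i, f i) := by
  choose k hk using hf
  obtain ⟨c, hc⟩ := hcard
  refine ⟨∑ i, k i + c, ?_⟩
  simp only [hk, Finset.sum_add_distrib, ← Finset.mul_sum, Finset.sum_const, Finset.card_univ, hc]
  ring

open Finset in
/-- Auxiliary form of `exists_sum_mul_sign_sub_eq_zero` for weights of positive sum. -/
theorem exists_sum_mul_sign_sub_eq_zero_of_pos {ι : Type*} [Fintype ι] (r : ι → ℝ)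
    (hr : Function.Injective r) (ε : ι → ℤ) (hε : ∀ i, ε i = 1 ∨ ε i = -1)
    (hcard : Odd (Fintype.card ι)) (hpos : 0 < ∑ i, ε i) :
    ∃ i, ∑ j, ε j * (SignType.sign (r i - r j) : ℤ) = 0 := by
  classical
  set G : ι → ℤ := fun i => ∑ j, ε j * (if r j ≤ r i then 1 else -1) with hG
  have hGodd (i : ι) : Odd (G i) := by
    refine Int.odd_sum_univ_of_odd _ (fun j => ?_) hcard
    rcases hε j with h | h <;> simp only [h] <;> split_ifs <;> decide
  have hne : (univ : Finset ι).Nonempty :=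
    Finset.card_pos.mp (by simpa using hcard.pos)
  obtain ⟨m, -, hm⟩ := exists_max_image univ r hne
  have hGm : G m = ∑ i, ε i :=
    sum_congr rfl fun j hj => by simp [hm j hj]
  obtain ⟨i, hi, hmin⟩ := exists_min_image (univ.filter fun i => 0 < G i) r
    ⟨m, by simpa [hGm] using hpos⟩
  simp only [mem_filter, mem_univ, true_and] at hi hmin
  have hlt : ∑ j, ε j * (if r j < r i then 1 else -1) = G i - 2 * ε i := by
    have : 2 * ε i = ∑ j, if j = i then 2 * ε j else 0 := by simp
    rw [this, hG, ← sum_sub_distrib]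
    refine sum_congr rfl fun j _ => ?_
    by_cases h : j = i
    · subst h; simp; ring
    · simp [h, le_iff_lt_or_eq, hr.eq_iff]
  have hsign : ∑ j, ε j * (SignType.sign (r i - r j) : ℤ) = G i - ε i := by
    have : ε i = ∑ j, if j = i then ε j else 0 := by simp
    rw [this, hG, ← sum_sub_distrib]
    refine sum_congr rfl fun j _ => ?_
    rcases lt_trichotomy (r j) (r i) with h | h | h
    · have hji : j ≠ i := fun e => by simp [e] at h
      simp [hji, h.le, sign_pos (sub_pos.mpr h)]
    · obtain rfl := hr h
      simp
    · have hji : j ≠ i := fun e => by simp [e] at h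
      simp [hji, h.not_ge, sign_neg (sub_neg.mpr h)]
  have hnonpos : G i - 2 * ε i ≤ 0 := by
    rw [← hlt]
    by_cases hex : (univ.filter fun j => r j < r i).Nonempty
    · obtain ⟨p, hp, hmax⟩ := exists_max_image _ r hex
      simp only [mem_filter, mem_univ, true_and] at hp hmax
      have hGp : ¬ 0 < G p := fun h => (hmin p h).not_gt hp
      refine le_trans (le_of_eq (sum_congr rfl fun j _ => ?_)) (not_lt.mp hGp)
      have : r j < r i ↔ r j ≤ r p := ⟨hmax j, fun h => h.trans_lt hp⟩
      simp [this]
    · simp only [not_nonempty_iff_eq_empty, filter_eq_empty_iff, mem_univ, true_implies] at hex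
      simp [hex, hpos.le]
  refine ⟨i, ?_⟩
  rw [hsign]
  obtain ⟨k, hk⟩ := hGodd i
  rcases hε i with h | h <;> omega

/-- Given an odd number of distinct reals `r j` with weights `ε j = ±1`, some `r i` has the same
total weight on its left as on its right. -/
theorem exists_sum_mul_sign_sub_eq_zero {ι : Type*} [Fintype ι] (r : ι → ℝ)
    (hr : Function.Injective r) (ε : ι → ℤ) (hε : ∀ i, ε i = 1 ∨ ε i = -1)
    (hcard : Odd (Fintype.card ι)) :
    ∃ i, ∑ j, ε j * (SignType.sign (r i - r j) : ℤ) = 0 := by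
  have hodd : Odd (∑ i, ε i) := by
    refine Int.odd_sum_univ_of_odd _ (fun j => ?_) hcard
    rcases hε j with h | h <;> rw [h] <;> decide
  rcases lt_trichotomy (∑ i, ε i) 0 with h | h | h
  · obtain ⟨i, hi⟩ := exists_sum_mul_sign_sub_eq_zero_of_pos r hr (fun i => -ε i)
      (fun i => by rcases hε i with h | h <;> simp [h]) hcard (by simpa using h)
    exact ⟨i, by simpa using hi⟩
  · simp [h] at hodd
  · exact exists_sum_mul_sign_sub_eq_zero_of_pos r hr ε hε hcard h

/-- A subspace of dimension at least two in an odd-dimensional coordinate space, in which every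
nonzero vector has at most one zero coordinate, contains a nonzero vector with as many positive as
negative coordinates. -/
theorem Submodule.exists_ne_zero_sum_sign_eq_zero {ι : Type*} [Fintype ι]
    (hcard : Odd (Fintype.card ι)) (W : Submodule ℝ (ι → ℝ)) (hW : 1 < Module.finrank ℝ W)
    (hzero : ∀ x ∈ W, ∀ i j, i ≠ j → x i = 0 → x j = 0 → x = 0) :
    ∃ x ∈ W, x ≠ 0 ∧ ∑ i, (SignType.sign (x i) : ℤ) = 0 := by
  classical
  obtain ⟨u, hu, w, hw, huw⟩ : ∃ u ∈ W, ∃ w ∈ W, LinearIndependent ℝ ![u, w] := by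
    obtain ⟨f, hf⟩ := exists_linearIndependent_of_le_finrank (R := ℝ) (M := W) (n := 2) hW
    refine ⟨f 0, (f 0).2, f 1, (f 1).2, ?_⟩
    rw [LinearIndependent.pair_iff' (by simpa using hf.ne_zero 0)]
    intro a ha
    have := LinearIndependent.pair_iff.mp
      (show LinearIndependent ℝ ![f 0, f 1] by convert hf using 1; ext i; fin_cases i <;> rfl)
      a (-1) (Subtype.ext (by simp [ha]))
    simp at this
  rw [LinearIndependent.pair_iff] at huw
  have hcommon (i : ι) (hui : u i = 0) : w i ≠ 0 := by
    intro hwi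
    have hu0 : u ≠ 0 := fun h => by simpa using huw 1 0 (by simp [h])
    obtain ⟨j, hj⟩ := Function.ne_iff.mp hu0
    have hij : i ≠ j := by rintro rfl; exact hj hui
    have h0 : w j • u + (-u j) • w = 0 :=
      hzero _ (W.add_mem (W.smul_mem _ hu) (W.smul_mem _ hw)) i j hij
        (by simp [hui, hwi]) (by simp; ring)
    exact hj (neg_eq_zero.mp (huw _ _ h0).2)
  obtain ⟨c, hc⟩ := (Set.finite_range fun i => -w i / u i).exists_notMem
  set v : ι → ℝ := w + c • u with hv
  have hvW : v ∈ W := W.add_mem hw (W.smul_mem _ hu)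
  have hv0 (i : ι) : v i ≠ 0 := by
    intro h
    simp only [hv, Pi.add_apply, Pi.smul_apply, smul_eq_mul] at h
    by_cases hui : u i = 0
    · exact hcommon i hui (by simpa [hui] using h)
    · exact hc ⟨i, by rw [div_eq_iff hui]; linarith⟩
  have hne (s : ℝ) : s • v - u ≠ 0 := by
    intro h
    obtain ⟨h1, h2⟩ := huw (s * c - 1) s (by rw [← h, hv]; module)
    simp [h2] at h1
  have hr : Function.Injective fun i => u i / v i := by
    intro i j hij
    by_contra hne'
    refine hne (u i / v i) (hzero _ (W.sub_mem (W.smul_mem _ hvW) hu) i j hne' ?_ ?_)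
    · simp [hv0 i]
    · simp only at hij
      simp [hij, hv0 j]
  obtain ⟨i, hi⟩ := exists_sum_mul_sign_sub_eq_zero _ hr (fun i => (SignType.sign (v i) : ℤ))
    (fun i => by rcases (hv0 i).lt_or_gt with h | h <;> simp [h]) hcard
  refine ⟨(u i / v i) • v - u, W.sub_mem (W.smul_mem _ hvW) hu, hne _, ?_⟩
  rw [← hi]
  refine Finset.sum_congr rfl fun j _ => ?_
  have : ((u i / v i) • v - u) j = v j * (u i / v i - u j / v j) := by
    have := hv0 j
    simp only [Pi.sub_apply, Pi.smul_apply, smul_eq_mul]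
    field_simp
  rw [this, sign_mul, SignType.coe_mul]

/-- An affine dependence supported on a set of affinely independent points vanishes. -/
theorem AffineIndependent.eq_zero_of_forall_notMem {ι E : Type*} [Fintype ι] [AddCommGroup E]
    [Module ℝ E] {A : ι → E} {s : Finset ι} (hs : AffineIndependent ℝ fun i : s => A i)
    {x : ι → ℝ} (hx : ∑ i, x i = 0) (hxA : ∑ i, x i • A i = 0) (hxs : ∀ i ∉ s, x i = 0) :
    x = 0 := by
  have h1 : ∑ i ∈ s, x i = 0 := by
    rw [← hx]
    exact Finset.sum_subset s.subset_univ fun i _ hi => hxs i hi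
  have h2 : ∑ i ∈ s, x i • A i = 0 := by
    rw [← hxA]
    exact Finset.sum_subset s.subset_univ fun i _ hi => by simp [hxs i hi]
  rw [affineIndependent_iff] at hs
  have := hs Finset.univ (fun i => x i) (by rw [← h1]; exact Finset.sum_coe_sort s x)
    (by rw [← h2]; exact Finset.sum_coe_sort s fun i => x i • A i)
  ext i
  by_cases hi : i ∈ s
  · exact this ⟨i, hi⟩ (Finset.mem_univ _)
  · exact hxs i hi


/-- Even case: for `n + 3` points in general position in ℝⁿ with `n` even,
there is a nonzero solution `x̂` of the system `∑ x̂ᵢ Aᵢ = 0`, `∑ x̂ᵢ = 0` with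
exactly `(n + 2) / 2` strictly positive and exactly `(n + 2) / 2` strictly
negative coordinates. -/
theorem exists_balanced_solution_even
    (n : ℕ) (hn : 0 < n) (heven : Even n)
    (A : Fin (n + 3) → EuclideanSpace ℝ (Fin n))
    (hgen : ∀ s : Finset (Fin (n + 3)), s.card = n + 1 →
      AffineIndependent ℝ (fun i : s => A i)) :
    ∃ x : Fin (n + 3) → ℝ, x ≠ 0 ∧
      (∑ i, x i • A i = 0) ∧ (∑ i, x i = 0) ∧
      (Finset.univ.filter fun i => 0 < x i).card = (n + 2) / 2 ∧
      (Finset.univ.filter fun i => x i < 0).card = (n + 2) / 2 := by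
  let L : (Fin (n + 3) → ℝ) →ₗ[ℝ] EuclideanSpace ℝ (Fin n) × ℝ :=
    (Fintype.linearCombination ℝ A).prod (Fintype.linearCombination ℝ fun _ => (1 : ℝ))
  have hL (x : Fin (n + 3) → ℝ) : x ∈ LinearMap.ker L ↔ ∑ i, x i • A i = 0 ∧ ∑ i, x i = 0 := by
    simp [L, Fintype.linearCombination_apply]
  have hrank : 1 < Module.finrank ℝ (LinearMap.ker L) := by
    have h1 := L.finrank_range_add_finrank_ker
    have h2 := (LinearMap.range L).finrank_le
    simp only [Module.finrank_prod, finrank_euclideanSpace_fin, Module.finrank_self,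
      Module.finrank_fin_fun] at h1 h2
    omega
  have hzero : ∀ x ∈ LinearMap.ker L, ∀ i j, i ≠ j → x i = 0 → x j = 0 → x = 0 := by
    intro x hx i j hij hi hj
    obtain ⟨hxA, hx⟩ := (hL x).mp hx
    refine (hgen ({i, j} : Finset _)ᶜ ?_).eq_zero_of_forall_notMem hx hxA ?_
    · rw [Finset.card_compl, Finset.card_pair hij, Fintype.card_fin]
      omega
    · intro k hk
      simp only [Finset.mem_compl, Finset.mem_insert, Finset.mem_singleton, not_not] at hk
      rcases hk with rfl | rfl <;> assumption
  obtain ⟨x, hxL, hx0, hsum⟩ := Submodule.exists_ne_zero_sum_sign_eq_zero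
    (by rw [Fintype.card_fin]; exact heven.add_odd (by decide)) _ hrank hzero
  obtain ⟨hxA, hx⟩ := (hL x).mp hxL
  refine ⟨x, hx0, hxA, hx, ?_⟩
  have hdiff : ((Finset.univ.filter fun i => 0 < x i).card : ℤ)
      - (Finset.univ.filter fun i => x i < 0).card = 0 := by
    rw [← hsum, Finset.card_filter, Finset.card_filter]
    push_cast
    rw [← Finset.sum_sub_distrib]
    refine Finset.sum_congr rfl fun i _ => ?_
    rcases lt_trichotomy (x i) 0 with h | h | h <;> simp [h, h.not_gt]
  have htotal : (Finset.univ.filter fun i => 0 < x i).card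
      + (Finset.univ.filter fun i => x i < 0).card
      + (Finset.univ.filter fun i => x i = 0).card = n + 3 := by
    rw [Finset.card_filter, Finset.card_filter, Finset.card_filter, ← Finset.sum_add_distrib,
      ← Finset.sum_add_distrib]
    trans ∑ _i : Fin (n + 3), 1
    · refine Finset.sum_congr rfl fun i _ => ?_
      rcases lt_trichotomy (x i) 0 with h | h | h
      · simp [h, h.ne, h.not_gt]
      · simp [h]
      · simp [h, h.ne', h.not_gt]
    · simp
  have hle : (Finset.univ.filter fun i => x i = 0).card ≤ 1 := by
    refine Finset.card_le_one.mpr fun i hi j hj => ?_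
    by_contra hij
    exact hx0 (hzero x hxL i j hij (by simpa using hi) (by simpa using hj))
  obtain ⟨k, hk⟩ := heven
  omega
end
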